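/- arXiv:1406.0263 — 6 statements merged into one kernel-verified Lean document; each statement's English description precedes it below -/
import Mathlib

section
/- Let w be a string of length n over an alphabet Σ equipped with two mutually opposite total orders ≺₀, ≺₁, and let ŵ = w$ with the sentinel conventions. Then for every position i with 1 ≤ i ≤ n there is a unique ℓ ∈ {0,1} such that λ_ℓ(i) = [i..i] and λ_{1−ℓ}(i) = [i..j] for some j > i. -/
variable {α : Type*}

/-- The substring `w[i..j]` of a 1-indexed string given as a function `w : ℕ → α`. -/
def substr (w : ℕ → α) (i j : ℕ) : List α :=
  (List.range (j + 1 - i)).map (fun k => w (i + k))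

/-- `u` is a Lyndon word w.r.t. the strict order `lt`:
`u` is nonempty and lexicographically smaller than each of its nonempty proper suffixes. -/
def IsLyndon (lt : α → α → Prop) (u : List α) : Prop :=
  u ≠ [] ∧ ∀ v, v ≠ [] → v ≠ u → v <:+ u → List.Lex lt u v

/-- `p` is a period of the substring `w[i..j]`. -/
def IsPeriod (w : ℕ → α) (i j p : ℕ) : Prop :=
  ∀ k, i ≤ k → k + p ≤ j → w k = w (k + p)

/-- `(i,j,p)` is a run of the string `w[1..n]`. -/
def IsRun (w : ℕ → α) (n i j p : ℕ) : Prop :=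
  1 ≤ i ∧ j ≤ n ∧ 1 ≤ p ∧ i + 2 * p ≤ j + 1 ∧
  IsPeriod w i j p ∧ (∀ q, 1 ≤ q → q < p → ¬ IsPeriod w i j q) ∧
  (i = 1 ∨ w (i - 1) ≠ w (i + p - 1)) ∧
  (j = n ∨ w (j + 1) ≠ w (j - p + 1))

/-- The set of runs of the string `w[1..n]`, as triples `(i,j,p)`. -/
def Runs (w : ℕ → α) (n : ℕ) : Set (ℕ × ℕ × ℕ) :=
  { r | IsRun w n r.1 r.2.1 r.2.2 }

/-- The exponent of a run `(i,j,p)`, i.e. `(j-i+1)/p`, as a rational number. -/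
def expo (r : ℕ × ℕ × ℕ) : ℚ :=
  ((r.2.1 : ℚ) - (r.1 : ℚ) + 1) / (r.2.2 : ℚ)

/-- `ŵ = w$`: positions `1..n` carry `w`, position `n+1` carries the sentinel `none`. -/
def hat (w : ℕ → α) (n : ℕ) : ℕ → Option α :=
  fun i => if i ≤ n then some (w i) else none

/-- Extension of a strict order `lt` on `α` to `Option α`, where the sentinel `none`
is smaller than every letter if `small = true`, and larger otherwise. -/
def extLT (small : Bool) (lt : α → α → Prop) : Option α → Option α → Prop
  | none, none => False
  | none, some _ => small = true
  | some _, none => small = false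
  | some a, some b => lt a b

/-- The order `≺_ℓ` on `Σ ∪ {$}` (for `ℓ ∈ {0,1}` encoded as `Bool`):
`$ ≺₀ a` and `a ≺₁ $` for every `a ∈ Σ`. -/
def hatOrd (lt0 lt1 : α → α → Prop) (ℓ : Bool) : Option α → Option α → Prop :=
  extLT (!ℓ) (cond ℓ lt1 lt0)

/-- `[i..j] = λ_ℓ(i)`: `ŵ[i..j]` is the longest Lyndon word (w.r.t. `lt`)
starting at position `i` in `ŵ = ŵ[1..n+1]`. -/
def IsLongestLyndon (lt : Option α → Option α → Prop) (what : ℕ → Option α)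
    (n i j : ℕ) : Prop :=
  i ≤ j ∧ j ≤ n + 1 ∧ IsLyndon lt (substr what i j) ∧
  ∀ j', j < j' → j' ≤ n + 1 → ¬ IsLyndon lt (substr what i j')

/-- `[iℓ..jℓ]` is an L-root of the run `(i,j,p)` w.r.t. `lt`. -/
def IsLRoot (lt : α → α → Prop) (w : ℕ → α) (i j p iℓ jℓ : ℕ) : Prop :=
  i ≤ iℓ ∧ jℓ ≤ j ∧ jℓ + 1 = iℓ + p ∧ IsLyndon lt (substr w iℓ jℓ)

/-- The set `B_r` for the run `r = (i,j,p)` of `w[1..n]`: all L-roots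
(as intervals, i.e. pairs `(iλ, jλ)`) of `r` w.r.t. the unique order `≺_ℓ`
with `ŵ[j+1] ≺_ℓ ŵ[j+1-p]`, except those starting at `i`. -/
def Br (lt0 lt1 : α → α → Prop) (w : ℕ → α) (n i j p : ℕ) : Set (ℕ × ℕ) :=
  { q | ∃ ℓ : Bool, hatOrd lt0 lt1 ℓ (hat w n (j + 1)) (hat w n (j + 1 - p)) ∧
        IsLRoot (cond ℓ lt1 lt0) w i j p q.1 q.2 ∧ q.1 ≠ i }

/-- `p` is a period of the list `s` (0-indexed form of `s[k] = s[k+p]` for `1 ≤ k ≤ |s|-p`). -/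
def ListPeriod (s : List α) (p : ℕ) : Prop :=
  ∀ k, k + p < s.length → s[k]? = s[k + p]?

theorem substr_eq_nil {β : Type*} (w : ℕ → β) {i j : ℕ} (h : j < i) : substr w i j = [] := by
  simp [substr, Nat.sub_eq_zero_of_le (Nat.succ_le_of_lt h)]

theorem substr_eq_cons {β : Type*} (w : ℕ → β) {i j : ℕ} (h : i ≤ j) :
    substr w i j = w i :: substr w (i + 1) j := by
  have e : j + 1 - i = (j + 1 - (i + 1)) + 1 := by omega
  unfold substr
  rw [e, List.range_succ_eq_map, List.map_cons, List.map_map]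
  simp only [Nat.add_zero, List.cons.injEq, true_and]
  refine List.map_congr_left fun k _ => ?_
  simp only [Function.comp_apply]
  congr 1
  omega

theorem drop_substr {β : Type*} (w : ℕ → β) (j d i : ℕ) :
    (substr w i j).drop d = substr w (i + d) j := by
  induction d generalizing i with
  | zero => rfl
  | succ d ih =>
    rcases Nat.lt_or_ge j i with h | h
    · rw [substr_eq_nil w h, substr_eq_nil w (by omega), List.drop_nil]
    · rw [substr_eq_cons w h, List.drop_succ_cons, ih]
      congr 1
      omega

theorem substr_isSuffix {β : Type*} (w : ℕ → β) {i t j : ℕ} (h : i ≤ t) :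
    substr w t j <:+ substr w i j := by
  have e := drop_substr w j (t - i) i
  rw [Nat.add_sub_cancel' h] at e
  exact e ▸ List.drop_suffix _ _

theorem length_substr {β : Type*} (w : ℕ → β) (i j : ℕ) :
    (substr w i j).length = j + 1 - i := by
  simp [substr]

theorem isLyndon_substr_iff {β : Type*} (lt : β → β → Prop) (w : ℕ → β) {i j : ℕ} (h : i ≤ j) :
    IsLyndon lt (substr w i j) ↔
      ∀ t, i < t → t ≤ j → List.Lex lt (substr w i j) (substr w t j) := by
  constructor
  · rintro ⟨-, hl⟩ t hit htj
    refine hl _ ?_ ?_ (substr_isSuffix w hit.le)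
    · rw [substr_eq_cons w htj]
      exact List.cons_ne_nil _ _
    · intro e
      have := congrArg List.length e
      simp only [length_substr] at this
      omega
  · intro hl
    refine ⟨by simp [substr_eq_cons w h], fun v hv hne hs => ?_⟩
    rw [List.suffix_iff_eq_drop, drop_substr] at hs
    rw [hs] at hv hne ⊢
    refine hl _ ?_ ?_
    · by_contra hc
      apply hne
      congr 1
      omega
    · by_contra hc
      exact hv (substr_eq_nil w (by omega))

theorem lex_substr_of_const_of_lt {β : Type*} {lt : β → β → Prop} {w : ℕ → β} {k : ℕ} {a : β}
    (hk : lt a (w k)) {s t : ℕ} (hst : s < t) (htk : t ≤ k)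
    (ha : ∀ m, s ≤ m → m < k → w m = a) :
    List.Lex lt (substr w s k) (substr w t k) := by
  induction hd : k - t generalizing s t with
  | zero =>
    obtain rfl : t = k := by omega
    rw [substr_eq_cons w hst.le, substr_eq_cons w le_rfl, ha s le_rfl hst]
    exact .rel hk
  | succ d ih =>
    rw [substr_eq_cons w (hst.le.trans htk), substr_eq_cons w htk, ha s le_rfl (by omega),
      ha t hst.le (by omega)]
    exact .cons (ih (by omega) (by omega) (fun m hm => ha m (by omega)) (by omega))

theorem isLyndon_substr_of_const_of_lt {β : Type*} {lt : β → β → Prop} {w : ℕ → β} {i k : ℕ}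
    (hik : i < k) (hk : lt (w i) (w k)) (hc : ∀ m, i ≤ m → m < k → w m = w i) :
    IsLyndon lt (substr w i k) :=
  (isLyndon_substr_iff lt w hik.le).2 fun _ hit htk => lex_substr_of_const_of_lt hk hit htk hc

theorem not_isLyndon_substr_of_const_of_gt {β : Type*} {lt : β → β → Prop}
    (hasymm : ∀ x y, lt x y → ¬ lt y x) {w : ℕ → β} {i k : ℕ}
    (hk : lt (w k) (w i)) (hc : ∀ m, i ≤ m → m < k → w m = w i) (hik : i < k)
    {j : ℕ} (hij : i < j) : ¬ IsLyndon lt (substr w i j) := by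
  have hirr : ∀ x, ¬ lt x x := fun x h => hasymm x x h h
  rw [isLyndon_substr_iff lt w hij.le]
  intro hl
  rcases Nat.lt_or_ge j k with hjk | hkj
  · have h := hl j hij le_rfl
    rw [substr_eq_cons w hij.le, substr_eq_cons w le_rfl, hc j hij.le hjk,
      substr_eq_nil w (Nat.lt_succ_self j)] at h
    cases h with
    | rel h => exact hirr _ h
    | cons h => simp at h
  · have h := hl k hik hkj
    rw [substr_eq_cons w hij.le, substr_eq_cons w hkj] at h
    generalize w i = x at h hk
    generalize w k = y at h hk
    cases h with
    | rel h => exact hasymm _ _ h hk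
    | cons h => exact hirr _ hk

theorem exists_isLongestLyndon_of_isLyndon {lt : Option α → Option α → Prop}
    {v : ℕ → Option α} {n i k : ℕ} (hik : i ≤ k) (hkn : k ≤ n + 1)
    (hl : IsLyndon lt (substr v i k)) : ∃ j, k ≤ j ∧ IsLongestLyndon lt v n i j := by
  classical
  have hkj := Nat.le_findGreatest (P := fun j => IsLyndon lt (substr v i j)) hkn hl
  exact ⟨_, hkj, hik.trans hkj, Nat.findGreatest_le _,
    Nat.findGreatest_spec (P := fun j => IsLyndon lt (substr v i j)) hkn hl,
    fun j' h h' => Nat.findGreatest_is_greatest h h'⟩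

theorem hatOrd_not {lt0 lt1 : α → α → Prop} (hopp : ∀ a b : α, lt0 a b ↔ lt1 b a) (ℓ : Bool)
    (x y : Option α) : hatOrd lt0 lt1 (!ℓ) x y ↔ hatOrd lt0 lt1 ℓ y x := by
  cases ℓ <;> cases x <;> cases y <;> simp [hatOrd, extLT, hopp]

theorem hatOrd_asymm {lt0 lt1 : α → α → Prop} [IsStrictTotalOrder α lt0]
    (hopp : ∀ a b : α, lt0 a b ↔ lt1 b a) (ℓ : Bool) (x y : Option α)
    (h : hatOrd lt0 lt1 ℓ x y) : ¬ hatOrd lt0 lt1 ℓ y x := by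
  have hasymm : ∀ a b, lt0 a b → ¬ lt0 b a := fun a b => asymm_of lt0
  cases ℓ <;> cases x <;> cases y <;> simp_all [hatOrd, extLT]

theorem exists_hatOrd_of_ne {lt0 lt1 : α → α → Prop} [IsStrictTotalOrder α lt0]
    (hopp : ∀ a b : α, lt0 a b ↔ lt1 b a) {x y : Option α} (hxy : x ≠ y) :
    ∃ ℓ, hatOrd lt0 lt1 ℓ x y := by
  cases x with
  | none =>
    cases y with
    | none => exact absurd rfl hxy
    | some b => exact ⟨false, by simp [hatOrd, extLT]⟩
  | some a =>
    cases y with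
    | none => exact ⟨true, by simp [hatOrd, extLT]⟩
    | some b =>
      rcases trichotomous_of lt0 a b with h | h | h
      · exact ⟨false, by simpa [hatOrd, extLT] using h⟩
      · exact absurd (congrArg some h) hxy
      · exact ⟨true, by simpa [hatOrd, extLT] using (hopp b a).1 h⟩


theorem runs_stmt0 {α : Type*} (lt0 lt1 : α → α → Prop)
    [IsStrictTotalOrder α lt0]
    (hopp : ∀ a b : α, lt0 a b ↔ lt1 b a)
    (n : ℕ) (w : ℕ → α) (i : ℕ) (h1 : 1 ≤ i) (hn : i ≤ n) :
    ∃! ℓ : Bool,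
      IsLongestLyndon (hatOrd lt0 lt1 ℓ) (hat w n) n i i ∧
      ∃ j, i < j ∧ IsLongestLyndon (hatOrd lt0 lt1 (!ℓ)) (hat w n) n i j := by
  classical
  have hex : ∃ k, i < k ∧ hat w n k ≠ hat w n i :=
    ⟨n + 1, by omega, by simp [hat, hn]⟩
  obtain ⟨hik, hne⟩ := Nat.find_spec hex
  have hkn : Nat.find hex ≤ n + 1 := Nat.find_min' hex ⟨by omega, by simp [hat, hn]⟩
  have hc : ∀ m, i ≤ m → m < Nat.find hex → hat w n m = hat w n i := by
    intro m him hmk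
    rcases him.eq_or_lt with rfl | him
    · rfl
    · by_contra hm
      exact Nat.find_min hex hmk ⟨him, hm⟩
  generalize Nat.find hex = k at hik hne hkn hc
  obtain ⟨ℓ, hℓ⟩ := exists_hatOrd_of_ne hopp hne
  have hlyn : IsLyndon (hatOrd lt0 lt1 (!ℓ)) (substr (hat w n) i k) :=
    isLyndon_substr_of_const_of_lt hik ((hatOrd_not hopp ℓ _ _).2 hℓ) hc
  refine ⟨ℓ, ⟨⟨le_rfl, by omega, ?_, fun j hij _ => ?_⟩, ?_⟩, ?_⟩
  · exact (isLyndon_substr_iff _ _ le_rfl).2 fun t h h' => absurd h h'.not_gt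
  · exact not_isLyndon_substr_of_const_of_gt (hatOrd_asymm hopp ℓ) hℓ hc hik hij
  · obtain ⟨j, hkj, hj⟩ := exists_isLongestLyndon_of_isLyndon hik.le hkn hlyn
    exact ⟨j, by omega, hj⟩
  · rintro ℓ' ⟨hlong, -⟩
    by_contra hℓ'
    rw [Bool.eq_not.2 hℓ'] at hlong
    exact hlong.2.2.2 k hik hkn hlyn
end

section
/- For any two distinct runs r and r′ of a string w, the sets Beg(B_r) and Beg(B_{r′}) are disjoint. -/
variable {α : Type*}

theorem List.Lex.exists_rel_of_length_le {α : Type*} {lt : α → α → Prop} {s t : List α}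
    (h : List.Lex lt s t) (hlen : t.length ≤ s.length) :
    ∃ k, ∃ hs : k < s.length, ∃ ht : k < t.length,
      (∀ m (hm : m < k), s[m] = t[m]) ∧ lt s[k] t[k] := by
  induction h with
  | nil => simp at hlen
  | rel h => exact ⟨0, by simp, by simp, by simp, by simpa using h⟩
  | cons _ ih =>
    obtain ⟨k, hs, ht, heq, hlt⟩ := ih (by simpa using hlen)
    refine ⟨k + 1, by simpa using hs, by simpa using ht, ?_, by simpa using hlt⟩
    rintro (_ | m) hm
    · rfl
    · simpa using heq m (by omega)

/-- A Lyndon factor is strictly smaller than its suffix at offset `d`, and the first mismatch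
occurs inside that suffix. -/
theorem IsLyndon.exists_mismatch {α : Type*} {lt : α → α → Prop} {w : ℕ → α} {b e p d : ℕ}
    (h : IsLyndon lt (substr w b e)) (he : e + 1 = b + p) (hd : 0 < d) (hdp : d < p) :
    ∃ k, d + k < p ∧ (∀ m < k, w (b + m) = w (b + (d + m))) ∧
      lt (w (b + k)) (w (b + (d + k))) := by
  have hlen : (substr w b e).length = p := by simp [substr]; omega
  have hdrop : ((substr w b e).drop d).length = p - d := by simp [hlen]
  have hlex := h.2 ((substr w b e).drop d)
    (by rw [← List.length_pos_iff]; omega)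
    (fun heq => by have := congrArg List.length heq; omega)
    (List.drop_suffix _ _)
  obtain ⟨k, _, ht, heq, hlt⟩ := hlex.exists_rel_of_length_le (by omega)
  refine ⟨k, by omega, fun m hm => ?_, ?_⟩
  · simpa [substr] using heq m hm
  · simpa [substr] using hlt

theorem IsLyndon.first_lt_last {α : Type*} {lt : α → α → Prop} {w : ℕ → α} {b e p : ℕ}
    (h : IsLyndon lt (substr w b e)) (he : e + 1 = b + p) (hp : 1 < p) :
    lt (w b) (w e) := by
  obtain ⟨k, hk, -, hlt⟩ := h.exists_mismatch (d := p - 1) he (by omega) (by omega)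
  obtain rfl : k = 0 := by omega
  rwa [add_zero, add_zero, show b + (p - 1) = e by omega] at hlt

/-- An L-root of a run that does not start at the left end of the run is preceded by its own
last letter. -/
theorem IsLRoot.apply_pred {α : Type*} {lt : α → α → Prop} {w : ℕ → α} {i j p b e : ℕ}
    (hper : IsPeriod w i j p) (h : IsLRoot lt w i j p b e) (hb : b ≠ i) :
    w (b - 1) = w e := by
  obtain ⟨hib, hej, he, -⟩ := h
  rw [hper (b - 1) (by omega) (by omega)]
  congr 1
  omega

theorem IsRun.left_le {α : Type*} {w : ℕ → α} {n i j i' j' p b e : ℕ}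
    (hr : IsRun w n i j p) (hr' : IsRun w n i' j' p)
    (hi : i ≤ b) (hej' : e ≤ j') (he : e + 1 = b + p) : i ≤ i' := by
  obtain ⟨-, -, hp, -, -, -, hleft, -⟩ := hr
  obtain ⟨hi', -, -, -, hper, -⟩ := hr'
  by_contra! hlt
  refine (hleft.resolve_left (by omega)) ?_
  rw [hper (i - 1) (by omega) (by omega)]
  congr 1
  omega

theorem IsRun.right_le {α : Type*} {w : ℕ → α} {n i j i' j' p b e : ℕ}
    (hr : IsRun w n i j p) (hr' : IsRun w n i' j' p)
    (hi : i ≤ b) (hej' : e ≤ j') (he : e + 1 = b + p) : j ≤ j' := by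
  obtain ⟨hi₀, hj, hp, -, hper, -⟩ := hr
  obtain ⟨-, -, -, -, -, -, -, hright⟩ := hr'
  by_contra! hlt
  refine (hright.resolve_left (by omega)) ?_
  rw [hper (j' - p + 1) (by omega) (by omega)]
  congr 1
  omega

/-- Two runs of the same period sharing a factor of that length coincide. -/
theorem IsRun.eq_of_common_factor {α : Type*} {w : ℕ → α} {n i j i' j' p b e : ℕ}
    (hr : IsRun w n i j p) (hr' : IsRun w n i' j' p) (hi : i ≤ b) (hi' : i' ≤ b)
    (hej : e ≤ j) (hej' : e ≤ j') (he : e + 1 = b + p) : i = i' ∧ j = j' :=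
  ⟨(hr.left_le hr' hi hej' he).antisymm (hr'.left_le hr hi' hej he),
    (hr.right_le hr' hi hej' he).antisymm (hr'.right_le hr hi' hej he)⟩

/-- No Lyndon factor starting with an L-root of a run is longer than that L-root, provided
the letter breaking the run is smaller than the one the period predicts. -/
theorem IsLRoot.le_of_isLyndon {α : Type*} {lt : α → α → Prop} [Std.Asymm lt]
    {w : ℕ → α} {n i j p b e e' p' : ℕ} (hp : 1 ≤ p)
    (hper : IsPeriod w i j p) (h : IsLRoot lt w i j p b e)
    (hbreak : j + 1 ≤ n → lt (w (j + 1)) (w (j + 1 - p)))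
    (h' : IsLyndon lt (substr w b e')) (he' : e' + 1 = b + p') (hn : e' ≤ n) : p' ≤ p := by
  obtain ⟨hib, hej, he, -⟩ := h
  by_contra! hlt
  obtain ⟨k, hk, heq, hkl⟩ := h'.exists_mismatch he' hp hlt
  have hirr : ∀ a, ¬ lt a a := fun a ha => Std.Asymm.asymm a a ha ha
  rw [show b + (p + k) = b + k + p by omega] at hkl
  rcases Nat.lt_or_ge j (b + k + p) with hjk | hjk
  · have hb := hbreak (by omega)
    obtain ⟨m, hm⟩ : ∃ m, j + 1 - p = b + m := ⟨j + 1 - p - b, by omega⟩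
    have hj : j + 1 = b + (p + m) := by omega
    rw [hm, hj] at hb
    rcases Nat.lt_or_ge m k with hmk | hmk
    · rw [heq m hmk] at hb
      exact hirr _ hb
    · obtain rfl : m = k := by omega
      rw [show b + (p + m) = b + m + p by omega] at hb
      exact Std.Asymm.asymm _ _ hkl hb
  · rw [← hper (b + k) (by omega) hjk] at hkl
    exact hirr _ hkl

theorem hatOrd_hat_of_le {α : Type*} {lt0 lt1 : α → α → Prop} {w : ℕ → α} {n x y : ℕ} {ℓ : Bool}
    (h : hatOrd lt0 lt1 ℓ (hat w n x) (hat w n y)) (hx : x ≤ n) (hy : y ≤ n) :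
    cond ℓ lt1 lt0 (w x) (w y) := by
  simpa [hatOrd, hat, hx, hy, extLT] using h

theorem runs_stmt2 {α : Type*} (lt0 lt1 : α → α → Prop)
    [IsStrictTotalOrder α lt0]
    (hopp : ∀ a b : α, lt0 a b ↔ lt1 b a)
    (n : ℕ) (w : ℕ → α) (i j p i' j' p' : ℕ)
    (hr : IsRun w n i j p) (hr' : IsRun w n i' j' p')
    (hne : (i, j, p) ≠ (i', j', p')) :
    Prod.fst '' Br lt0 lt1 w n i j p ∩ Prod.fst '' Br lt0 lt1 w n i' j' p' = ∅ := by
  rw [Set.eq_empty_iff_forall_notMem]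
  rintro _ ⟨⟨⟨b, e⟩, ⟨ℓ, ho, hroot, hbi⟩, rfl⟩, ⟨⟨b', e'⟩, ⟨ℓ', ho', hroot', hbi'⟩, hbb'⟩⟩
  dsimp only at hroot hbi hroot' hbi' hbb'
  obtain rfl := hbb'.symm
  have hasymm : ∀ x y, lt0 x y → ¬ lt0 y x := fun _ _ h h' => irrefl_of lt0 _ (trans_of lt0 h h')
  have hA : ∀ ℓ : Bool, Std.Asymm (cond ℓ lt1 lt0) := by
    rintro (_ | _)
    · exact ⟨hasymm⟩
    · exact ⟨fun x y h h' => hasymm y x ((hopp _ _).2 h) ((hopp _ _).2 h')⟩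
  have hp := hr.2.2.1
  have hp' := hr'.2.2.1
  have hjn := hr.2.1
  have hjn' := hr'.2.1
  have hpred := hroot.apply_pred hr.2.2.2.2.1 hbi
  have hpred' := hroot'.apply_pred hr'.2.2.2.2.1 hbi'
  have hpp : p = p' := by
    by_cases hℓ : ℓ = ℓ'
    · subst hℓ
      have := hA ℓ
      exact le_antisymm
        (hroot'.le_of_isLyndon hp' hr'.2.2.2.2.1
          (fun h => hatOrd_hat_of_le ho' h (by omega)) hroot.2.2.2 hroot.2.2.1
          (hroot.2.1.trans hjn))
        (hroot.le_of_isLyndon hp hr.2.2.2.2.1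
          (fun h => hatOrd_hat_of_le ho h (by omega)) hroot'.2.2.2 hroot'.2.2.1
          (hroot'.2.1.trans hjn'))
    · obtain ⟨-, -, he, hL⟩ := hroot
      obtain ⟨-, -, he', hL'⟩ := hroot'
      have hirr : ∀ (ℓ : Bool) a, ¬ cond ℓ lt1 lt0 a a := fun ℓ a h => (hA ℓ).asymm a a h h
      rcases hp.eq_or_lt with h1 | h1 <;> rcases hp'.eq_or_lt with h1' | h1'
      · omega
      · have := hL'.first_lt_last he' h1'
        rw [← hpred', hpred, show e = b by omega] at this
        exact (hirr _ _ this).elim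
      · have := hL.first_lt_last he h1
        rw [← hpred, hpred', show e' = b by omega] at this
        exact (hirr _ _ this).elim
      · have hlt := hL.first_lt_last he h1
        have hlt' := hL'.first_lt_last he' h1'
        rw [← hpred] at hlt
        rw [← hpred'] at hlt'
        cases ℓ <;> cases ℓ' <;> simp only [cond_true, cond_false, ← hopp] at hlt hlt' hℓ
        · exact (hℓ trivial).elim
        · exact (hasymm _ _ hlt hlt').elim
        · exact (hasymm _ _ hlt hlt').elim
        · exact (hℓ trivial).elim
  subst hpp
  have hee : e = e' := by have := hroot.2.2.1; have := hroot'.2.2.1; omega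
  subst hee
  obtain ⟨rfl, rfl⟩ := hr.eq_of_common_factor hr' hroot.1 hroot'.1 hroot.2.1 hroot'.2.1
    hroot.2.2.1
  exact hne rfl
end

section
/- For any run r of a string w with exponent e_r, the set B_r satisfies |Beg(B_r)| = |B_r| ≥ ⌊e_r − 1⌋ ≥ 1. -/
variable {α : Type*}

/-- The bi-infinite `p`-periodic extension of `w[i..i+p-1]`, shifted to start at `0`. -/
def periodicExt (w : ℕ → α) (i p : ℕ) (z : ℤ) : α :=
  w (i + (z % p).toNat)

/-- The factor of length `p` of the bi-infinite word `f` starting at `z`. -/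
def window (f : ℤ → α) (p : ℕ) (z : ℤ) : List α :=
  (List.range p).map (fun t : ℕ => f (z + t))

lemma periodicExt_congr (w : ℕ → α) (i p : ℕ) {y z : ℤ} (h : y % p = z % p) :
    periodicExt w i p y = periodicExt w i p z := by
  simp only [periodicExt, h]

lemma IsPeriod.eq_add_mul {w : ℕ → α} {i j p : ℕ} (h : IsPeriod w i j p) {k : ℕ} (hk : i ≤ k)
    (m : ℕ) (hm : k + m * p ≤ j) : w k = w (k + m * p) := by
  induction m with
  | zero => simp
  | succ m ih =>
    rw [Nat.succ_mul] at hm ⊢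
    rw [ih (by omega), h (k + m * p) (by omega) (by omega), Nat.add_assoc]

lemma IsPeriod.eq_periodicExt {w : ℕ → α} {i j p : ℕ} (h : IsPeriod w i j p)
    {k : ℕ} (hk : k + i ≤ j) : w (i + k) = periodicExt w i p k := by
  have hmod : ((k : ℤ) % p).toNat = k % p := by
    rw [← Int.natCast_mod, Int.toNat_natCast]
  have hdiv : i + k % p + k / p * p = i + k := by
    rw [Nat.add_assoc, Nat.mul_comm, Nat.mod_add_div]
  rw [periodicExt, hmod, h.eq_add_mul (k := i + k % p) (by omega) (k / p) (by omega), hdiv]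

lemma IsPeriod.substr_eq_window {w : ℕ → α} {i j p : ℕ} (h : IsPeriod w i j p) (hp : 1 ≤ p)
    {k : ℕ} (hk : i + k + p ≤ j + 1) :
    substr w (i + k) (i + k + p - 1) = window (periodicExt w i p) p k := by
  have hlen : i + k + p - 1 + 1 - (i + k) = p := by omega
  rw [substr, window, hlen]
  refine List.map_congr_left fun t ht => ?_
  rw [List.mem_range] at ht
  rw [Nat.add_assoc, h.eq_periodicExt (by omega), Nat.cast_add]

lemma window_periodicExt_congr (w : ℕ → α) (i p : ℕ) {y z : ℤ} (h : y % p = z % p) :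
    window (periodicExt w i p) p y = window (periodicExt w i p) p z :=
  List.map_congr_left fun _ _ => periodicExt_congr w i p (Int.emod_add_cancel_right _ |>.mpr h)

lemma window_rotate (w : ℕ → α) (i p : ℕ) (z : ℤ) (d : ℕ) :
    (window (periodicExt w i p) p z).rotate d = window (periodicExt w i p) p (z + d) := by
  refine List.ext_getElem (by simp [window]) fun k h₁ h₂ => ?_
  rw [List.getElem_rotate]
  simp only [window, List.getElem_map, List.getElem_range, List.length_map, List.length_range]
  apply periodicExt_congr
  push_cast
  rw [Int.add_emod_emod]
  ring_nf

/-- Two distinct positions within one period with equal windows yield a smaller period. -/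
lemma isPeriod_of_window_eq {w : ℕ → α} {i j p : ℕ} (h : IsPeriod w i j p) (hp : 1 ≤ p)
    {z : ℤ} {d : ℕ}
    (hz : window (periodicExt w i p) p z = window (periodicExt w i p) p (z + d)) :
    IsPeriod w i j d := by
  have hp0 : (p : ℤ) ≠ 0 := by omega
  have key : ∀ y : ℤ, periodicExt w i p y = periodicExt w i p (y + d) := by
    intro y
    obtain ⟨t, ht⟩ := Int.eq_ofNat_of_zero_le (Int.emod_nonneg (y - z) hp0)
    have htp : t < p := by
      have := Int.emod_lt_of_pos (y - z) (b := p) (by omega)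
      omega
    have hy : (z + t) % p = y % p := by
      change _ = (t : ℤ) at ht
      rw [← ht, Int.add_emod_emod]
      ring_nf
    have hy' : (z + d + t) % p = (y + d) % p := by
      rw [show z + d + t = z + t + (d : ℤ) by ring]
      exact Int.emod_add_cancel_right _ |>.mpr hy
    rw [← periodicExt_congr w i p hy, ← periodicExt_congr w i p hy']
    exact List.map_inj_left.mp hz t (List.mem_range.mpr htp)
  intro k hik hkj
  obtain ⟨k, rfl⟩ := Nat.exists_eq_add_of_le hik
  rw [h.eq_periodicExt (by omega), Nat.add_assoc, h.eq_periodicExt (by omega), key,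
    Nat.cast_add]

lemma List.Lex.prefix_or_append {lt : α → α → Prop} {u v : List α} (h : List.Lex lt u v) :
    (∃ y, y ≠ [] ∧ v = u ++ y) ∨ ∀ s t, List.Lex lt (u ++ s) (v ++ t) := by
  induction h with
  | nil => exact Or.inl ⟨_, List.cons_ne_nil _ _, rfl⟩
  | rel h => exact Or.inr fun s t => List.Lex.rel h
  | cons _ ih =>
    rcases ih with ⟨y, hy, rfl⟩ | ih
    · exact Or.inl ⟨y, hy, rfl⟩
    · exact Or.inr fun s t => List.Lex.cons (ih s t)

lemma List.Lex.of_append_left {lt : α → α → Prop} [IsStrictTotalOrder α lt] {s u v : List α}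
    (h : List.Lex lt (s ++ u) (s ++ v)) : List.Lex lt u v := by
  induction s with
  | nil => exact h
  | cons a s ih =>
    cases h with
    | rel h => exact absurd h (irrefl a)
    | cons h => exact ih h

/-- A word strictly smaller than all its nontrivial rotations is a Lyndon word. -/
lemma isLyndon_of_lt_rotations {lt : α → α → Prop} [IsStrictTotalOrder α lt] {u : List α}
    (hu : u ≠ []) (h : ∀ x y, x ≠ [] → y ≠ [] → u = x ++ y → List.Lex lt u (y ++ x)) :
    IsLyndon lt u := by
  refine ⟨hu, fun v hv hvu ⟨x, hx⟩ => ?_⟩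
  have hx0 : x ≠ [] := by
    rintro rfl
    exact hvu hx
  rcases trichotomous_of (List.Lex lt) u v with huv | huv | huv
  · exact huv
  · exact absurd huv.symm hvu
  · exfalso
    have hrot := h x v hx0 hv hx.symm
    rcases huv.prefix_or_append with ⟨y, hy, rfl⟩ | huv
    · rcases hrot.of_append_left.prefix_or_append with ⟨z, hz, rfl⟩ | hyx
      · have hlen := congrArg List.length hx
        have := List.length_pos_iff.mpr hz
        simp only [List.length_append] at hlen
        omega
      · have hlt := hyx v v
        rw [hx] at hlt
        exact asymm hlt (h v y hv hy rfl)
    · exact asymm hrot (by simpa using huv x [])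

lemma IsRun.exists_isLyndon_window {lt : α → α → Prop} [IsStrictTotalOrder α lt]
    {w : ℕ → α} {n i j p : ℕ} (h : IsRun w n i j p) :
    ∃ c : ℕ, 1 ≤ c ∧ c ≤ p ∧ IsLyndon lt (window (periodicExt w i p) p c) := by
  classical
  obtain ⟨-, -, hp, -, hper, hmin, -, -⟩ := h
  have hp0 : (p : ℤ) ≠ 0 := by omega
  have : IsStrictTotalOrder (List α) (List.Lex lt) :=
    { isStrictWeakOrder_of_isOrderConnected with }
  let _ : LinearOrder (List α) := linearOrderOfSTO (List.Lex lt)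
  obtain ⟨c, hc, hle⟩ := Finset.exists_min_image (Finset.range p)
    (fun t : ℕ => window (periodicExt w i p) p (t + 1)) ⟨0, Finset.mem_range.mpr hp⟩
  rw [Finset.mem_range] at hc
  have hle' : ∀ z : ℤ, ¬ List.Lex lt (window (periodicExt w i p) p z)
      (window (periodicExt w i p) p (c + 1)) := by
    intro z
    obtain ⟨t, ht⟩ := Int.eq_ofNat_of_zero_le (Int.emod_nonneg (z - 1) hp0)
    change _ = (t : ℤ) at ht
    have htp : t < p := by
      have := Int.emod_lt_of_pos (z - 1) (b := p) (by omega)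
      omega
    have hz : z % p = (t + 1 : ℤ) % p := by
      rw [← ht, Int.emod_add_emod]
      ring_nf
    rw [window_periodicExt_congr w i p hz]
    exact not_lt_of_ge (hle t (Finset.mem_range.mpr htp))
  refine ⟨c + 1, by omega, by omega, ?_⟩
  push_cast
  refine isLyndon_of_lt_rotations ?_ fun x y hx hy hxy => ?_
  · rw [← List.length_pos_iff]
    simpa [window, Nat.pos_iff_ne_zero] using Nat.ne_of_gt hp
  · have hrot : y ++ x = window (periodicExt w i p) p (c + 1 + x.length) := by
      rw [← window_rotate, hxy, List.rotate_append_length_eq]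
    have hlen : p = x.length + y.length := by
      simpa [window] using congrArg List.length hxy
    have hx' := List.length_pos_iff.mpr hx
    have hy' := List.length_pos_iff.mpr hy
    rw [hrot]
    rcases trichotomous_of (List.Lex lt) (window (periodicExt w i p) p (c + 1))
      (window (periodicExt w i p) p (c + 1 + x.length)) with hlt | heq | hgt
    · exact hlt
    · exact absurd (isPeriod_of_window_eq hper hp heq) (hmin _ hx' (by omega))
    · exact absurd hgt (hle' _)

lemma IsRun.exists_hatOrd {lt0 lt1 : α → α → Prop} [IsStrictTotalOrder α lt0]
    (hopp : ∀ a b : α, lt0 a b ↔ lt1 b a) {w : ℕ → α} {n i j p : ℕ} (h : IsRun w n i j p) :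
    ∃ ℓ : Bool, hatOrd lt0 lt1 ℓ (hat w n (j + 1)) (hat w n (j + 1 - p)) := by
  obtain ⟨hi, hjn, hp, hij, -, -, -, hext⟩ := h
  have hprev : hat w n (j + 1 - p) = some (w (j + 1 - p)) := if_pos (by omega)
  by_cases hj : j = n
  · have hnext : hat w n (j + 1) = none := if_neg (by omega)
    exact ⟨false, by rw [hnext, hprev]; rfl⟩
  · have hnext : hat w n (j + 1) = some (w (j + 1)) := if_pos (by omega)
    have hne := hext.resolve_left hj
    rw [show j - p + 1 = j + 1 - p by omega] at hne
    rw [hnext, hprev]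
    rcases trichotomous_of lt0 (w (j + 1)) (w (j + 1 - p)) with hlt | heq | hgt
    · exact ⟨false, hlt⟩
    · exact absurd heq hne
    · exact ⟨true, (hopp _ _).mp hgt⟩

lemma Br_finite (lt0 lt1 : α → α → Prop) (w : ℕ → α) (n i j p : ℕ) :
    (Br lt0 lt1 w n i j p).Finite := by
  refine (Set.finite_Iic ((j + 1, j) : ℕ × ℕ)).subset ?_
  rintro ⟨a, b⟩ ⟨ℓ, -, ⟨-, hb, hab, -⟩, -⟩
  simp only at hb hab
  exact ⟨show a ≤ j + 1 by omega, hb⟩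

lemma Br_injOn_fst (lt0 lt1 : α → α → Prop) (w : ℕ → α) (n i j p : ℕ) :
    Set.InjOn Prod.fst (Br lt0 lt1 w n i j p) := by
  rintro ⟨a, b⟩ ⟨ℓ, -, ⟨-, -, hab, -⟩, -⟩ ⟨a', b'⟩ ⟨ℓ', -, ⟨-, -, hab', -⟩, -⟩ (rfl : a = a')
  simp only at hab hab'
  rw [show b = b' by omega]

lemma IsRun.le_ncard_Br {lt0 lt1 : α → α → Prop} [IsStrictTotalOrder α lt0]
    (hopp : ∀ a b : α, lt0 a b ↔ lt1 b a) {w : ℕ → α} {n i j p : ℕ} (h : IsRun w n i j p)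
    {m : ℕ} (hm : i + (m + 1) * p ≤ j + 1) : m ≤ (Br lt0 lt1 w n i j p).ncard := by
  obtain ⟨ℓ, hℓ⟩ := h.exists_hatOrd hopp
  have hswap : lt1 = Function.swap lt0 := by
    funext a b
    exact propext (hopp b a).symm
  have : IsStrictTotalOrder α (cond ℓ lt1 lt0) := by
    cases ℓ
    · assumption
    · rw [hswap]
      exact inferInstanceAs (IsStrictTotalOrder α (Function.swap lt0))
  obtain ⟨c, hc1, hcp, hlyn⟩ := h.exists_isLyndon_window (lt := cond ℓ lt1 lt0)
  obtain ⟨-, -, hp, -, hper, -, -, -⟩ := h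
  let g : ℕ → ℕ × ℕ := fun t => (i + (c + t * p), i + (c + t * p) + p - 1)
  have hg : Function.Injective g := fun s t hst => by
    have h₁ : i + (c + s * p) = i + (c + t * p) := congrArg Prod.fst hst
    exact Nat.eq_of_mul_eq_mul_right hp (by omega)
  have hsub : g '' (Finset.range m : Set ℕ) ⊆ Br lt0 lt1 w n i j p := by
    rintro _ ⟨t, ht, rfl⟩
    rw [Finset.mem_coe, Finset.mem_range] at ht
    have hle : (t + 2) * p ≤ (m + 1) * p := Nat.mul_le_mul_right p (by omega)
    rw [Nat.add_mul] at hle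
    have hend : i + (c + t * p) + p ≤ j + 1 := by omega
    refine ⟨ℓ, hℓ, ⟨?_, ?_, ?_, ?_⟩, ?_⟩
    · exact Nat.le_add_right _ _
    · change i + (c + t * p) + p - 1 ≤ j
      omega
    · change i + (c + t * p) + p - 1 + 1 = i + (c + t * p) + p
      omega
    · change IsLyndon _ (substr w (i + (c + t * p)) (i + (c + t * p) + p - 1))
      rw [hper.substr_eq_window hp hend,
        window_periodicExt_congr w i p (z := c) (by push_cast; simp)]
      exact hlyn
    · change i + (c + t * p) ≠ i
      omega
  calc m = (g '' (Finset.range m : Set ℕ)).ncard := by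
        rw [Set.ncard_image_of_injective _ hg, Set.ncard_coe_finset, Finset.card_range]
    _ ≤ _ := Set.ncard_le_ncard hsub (Br_finite ..)

theorem runs_stmt3 {α : Type*} (lt0 lt1 : α → α → Prop)
    [IsStrictTotalOrder α lt0]
    (hopp : ∀ a b : α, lt0 a b ↔ lt1 b a)
    (n : ℕ) (w : ℕ → α) (i j p : ℕ) (hrun : IsRun w n i j p) :
    (Prod.fst '' Br lt0 lt1 w n i j p).ncard = (Br lt0 lt1 w n i j p).ncard ∧
    ⌊expo (i, j, p) - 1⌋ ≤ ((Br lt0 lt1 w n i j p).ncard : ℤ) ∧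
    1 ≤ ⌊expo (i, j, p) - 1⌋ := by
  obtain ⟨-, -, hp, hij, -⟩ := id hrun
  have hpQ : (0 : ℚ) < p := by exact_mod_cast hp
  have hone : 1 ≤ ⌊expo (i, j, p) - 1⌋ := by
    have hijQ : (i : ℚ) + 2 * p ≤ j + 1 := by exact_mod_cast hij
    rw [Int.le_floor, expo, le_sub_iff_add_le, le_div_iff₀ hpQ]
    push_cast
    linarith
  refine ⟨(Br_injOn_fst ..).ncard_image, ?_, hone⟩
  obtain ⟨m, hm⟩ := Int.eq_ofNat_of_zero_le (zero_le_one.trans hone)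
  have hfloor : ((m : ℤ) : ℚ) ≤ expo (i, j, p) - 1 := Int.le_floor.mp hm.ge
  rw [expo, le_sub_iff_add_le, le_div_iff₀ hpQ] at hfloor
  push_cast at hfloor
  rw [hm]
  have hle : (i : ℚ) + (m + 1) * p ≤ j + 1 := by linarith
  exact_mod_cast hrun.le_ncard_Br hopp (m := m) (by exact_mod_cast hle)
end

section
/- (The Runs Theorem) Every string w of length n ≥ 1 contains at most n − 1 runs; in particular, the maximum number ρ(n) of runs in a string of length n satisfies ρ(n) < n. -/
variable {α : Type*}

/-- The infinite suffix of `s` starting at position `a`, ordered lexicographically. -/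
def suffixFrom {β : Type*} (s : ℕ → β) (a : ℕ) : Lex (ℕ → β) :=
  toLex fun t => s (a + t)

theorem suffixFrom_lt_iff {β : Type*} [LT β] (s : ℕ → β) (a b : ℕ) :
    suffixFrom s a < suffixFrom s b ↔
      ∃ m, (∀ t < m, s (a + t) = s (b + t)) ∧ s (a + m) < s (b + m) :=
  Iff.rfl

theorem suffixFrom_toDual_lt_iff {β : Type*} [LT β] (s : ℕ → β) (a b : ℕ) :
    suffixFrom (OrderDual.toDual ∘ s) a < suffixFrom (OrderDual.toDual ∘ s) b ↔
      suffixFrom s b < suffixFrom s a := by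
  simp only [suffixFrom_lt_iff, Function.comp_apply, OrderDual.toDual_lt_toDual,
    OrderDual.toDual_inj]
  simp only [eq_comm]

theorem suffixFrom_succ_lt {β : Type*} [Preorder β] {s : ℕ → β} {a b : ℕ} (h : s a = s b)
    (hlt : suffixFrom s a < suffixFrom s b) :
    suffixFrom s (a + 1) < suffixFrom s (b + 1) := by
  rw [suffixFrom_lt_iff] at hlt ⊢
  obtain ⟨m, hm, hlt⟩ := hlt
  cases m with
  | zero => simp [h] at hlt
  | succ m =>
    refine ⟨m, fun t ht => ?_, ?_⟩
    · simpa only [Nat.add_assoc, Nat.add_comm 1] using hm (t + 1) (by omega)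
    · simpa only [Nat.add_assoc, Nat.add_comm 1] using hlt

/-- `k + p` is the first position after `k` whose suffix is smaller than the one at `k`;
equivalently, the longest Lyndon factor starting at `k` has length `p`. -/
def NextSmallerSuffix {β : Type*} [LT β] (s : ℕ → β) (k p : ℕ) : Prop :=
  suffixFrom s (k + p) < suffixFrom s k ∧
    ∀ q, 0 < q → q < p → suffixFrom s k < suffixFrom s (k + q)

theorem NextSmallerSuffix.unique {β : Type*} [LinearOrder β] {s : ℕ → β} {k p p' : ℕ}
    (hp : 0 < p) (hp' : 0 < p') (h : NextSmallerSuffix s k p) (h' : NextSmallerSuffix s k p') :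
    p = p' := by
  rcases lt_trichotomy p p' with hlt | heq | hgt
  · exact absurd (h'.2 p hp hlt) h.1.asymm
  · exact heq
  · exact absurd (h.2 p' hp' hgt) h'.1.asymm

theorem NextSmallerSuffix.not_toDual_of_one {β : Type*} [LinearOrder β] {s : ℕ → β} {k p : ℕ}
    (hp : 0 < p) (h : NextSmallerSuffix s (k + 1) 1)
    (h' : NextSmallerSuffix (OrderDual.toDual ∘ s) (k + 1) p)
    (h₁ : s k = s (k + 1)) (h₂ : s k = s (k + p)) : False := by
  have hgt := (suffixFrom_toDual_lt_iff _ _ _).1 h'.1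
  obtain rfl | hp1 : p = 1 ∨ 1 < p := by omega
  · exact hgt.asymm h.1
  · have hlast := (suffixFrom_toDual_lt_iff _ _ _).1 (h'.2 (p - 1) (by omega) (by omega))
    rw [show k + 1 + (p - 1) = k + p by omega] at hlast
    have := suffixFrom_succ_lt (h₂.symm.trans h₁) hlast
    rw [show k + p + 1 = k + 1 + p by omega] at this
    exact (this.trans h.1).asymm hgt

theorem NextSmallerSuffix.not_toDual {β : Type*} [LinearOrder β] {s : ℕ → β} {k p p' : ℕ}
    (hp : 0 < p) (hp' : 0 < p') (h : NextSmallerSuffix s (k + 1) p)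
    (h' : NextSmallerSuffix (OrderDual.toDual ∘ s) (k + 1) p')
    (h₁ : s k = s (k + p)) (h₂ : s k = s (k + p')) : False := by
  obtain rfl | hp1 : p = 1 ∨ 1 < p := by omega
  · exact h.not_toDual_of_one hp' h' h₁ h₂
  obtain rfl | hp1' : p' = 1 ∨ 1 < p' := by omega
  · exact NextSmallerSuffix.not_toDual_of_one (s := OrderDual.toDual ∘ s) hp h' h h₂ h₁
  · exact (h.2 1 one_pos hp1).asymm
      ((suffixFrom_toDual_lt_iff _ _ _).1 (h'.2 1 one_pos hp1'))

/-- A sequence with least period `p` has a position in each window of length `p` whose suffix is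
smaller than all nontrivial rotations, already within the period starting there. -/
theorem exists_unbordered_min_rotation {β : Type*} [LinearOrder β] {u : ℕ → β} {p : ℕ}
    (hp : 0 < p) (hu : Function.Periodic u p)
    (hmin : ∀ q, 0 < q → q < p → ¬ Function.Periodic u q) :
    ∃ k, 0 < k ∧ k ≤ p ∧ ∀ q, 0 < q → q < p →
      ∃ m, m + q < p ∧ (∀ t < m, u (k + t) = u (k + q + t)) ∧ u (k + m) < u (k + q + m) := by
  have hmod : ∀ a b, a ≡ b [MOD p] → u a = u b := fun a b h => by
    rw [← hu.map_mod_nat a, ← hu.map_mod_nat b, h]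
  obtain ⟨a, ha, hamin⟩ := Finset.exists_min_image (Finset.range p)
    (fun a => suffixFrom u (a + 1)) ⟨0, by simpa using hp⟩
  have hle : ∀ b, suffixFrom u (a + 1) ≤ suffixFrom u b := fun b => by
    have hb : suffixFrom u ((b + (p - 1)) % p + 1) = suffixFrom u b := by
      refine congrArg toLex (funext fun t => hmod _ _ ?_)
      calc (b + (p - 1)) % p + 1 + t ≡ b + (p - 1) + 1 + t [MOD p] :=
            ((Nat.mod_modEq _ _).add_right 1).add_right t
        _ = b + t + p := by omega
        _ ≡ b + t [MOD p] := by simp [Nat.ModEq]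
    rw [← hb]
    exact hamin _ (by simpa using Nat.mod_lt _ hp)
  rw [Finset.mem_range] at ha
  refine ⟨a + 1, by omega, by omega, fun q hq hqp => ?_⟩
  have hne : suffixFrom u (a + 1) ≠ suffixFrom u (a + 1 + q) := fun h => hmin q hq hqp fun x => by
    have hx : u (a + 1 + (x + (p - (a + 1)))) = u (a + 1 + q + (x + (p - (a + 1)))) := congrFun h _
    rw [show a + 1 + (x + (p - (a + 1))) = x + p by omega,
      show a + 1 + q + (x + (p - (a + 1))) = x + q + p by omega, hu, hu] at hx
    exact hx.symm
  obtain ⟨m, hm, hlt⟩ := (suffixFrom_lt_iff _ _ _).1 (lt_of_le_of_ne (hle _) hne)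
  refine ⟨m, ?_, hm, hlt⟩
  by_contra! hmq
  refine (hle (a + 1 + (p - q))).not_gt ((suffixFrom_lt_iff _ _ _).2 ⟨m - (p - q), ?_, ?_⟩)
  · intro t ht
    have h := hm (p - q + t) (by omega)
    rwa [← Nat.add_assoc, show a + 1 + q + (p - q + t) = a + 1 + t + p by omega, hu] at h
  · rwa [show a + 1 + (p - q) + (m - (p - q)) = a + 1 + m by omega,
      ← hu (a + 1 + (m - (p - q))),
      show a + 1 + (m - (p - q)) + p = a + 1 + q + m by omega]

theorem exists_nextSmallerSuffix {β : Type*} [LinearOrder β] {s : ℕ → β} {i j p : ℕ}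
    (hp : 0 < p) (hij : i + 2 * p ≤ j + 1) (hper : IsPeriod s i j p)
    (hmin : ∀ q, 1 ≤ q → q < p → ¬ IsPeriod s i j q) (hlt : s (j + 1) < s (j + 1 - p)) :
    ∃ k, i < k ∧ k ≤ i + p ∧ NextSmallerSuffix s k p := by
  have hu : ∀ t, i + t ≤ j → s (i + t % p) = s (i + t) := fun t => by
    induction t using Nat.strong_induction_on with
    | _ t ih =>
      intro ht
      rcases lt_or_ge t p with h | h
      · rw [Nat.mod_eq_of_lt h]
      · rw [Nat.mod_eq_sub_mod h, ih (t - p) (by omega) (by omega),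
          hper (i + (t - p)) (by omega) (by omega)]
        congr 1
        omega
  obtain ⟨k, hk, hkp, hroot⟩ := exists_unbordered_min_rotation (u := fun t => s (i + t % p)) hp
    (fun t => by simp) fun q hq hqp h => hmin q hq hqp fun x hx hxj => by
      have := h (x - i)
      dsimp only at this
      rw [hu _ (by omega), hu _ (by omega), show i + (x - i) = x by omega,
        show i + (x - i + q) = x + q by omega] at this
      exact this.symm
  refine ⟨i + k, by omega, by omega, ?_, fun q hq hqp => ?_⟩
  · refine (suffixFrom_lt_iff _ _ _).2 ⟨j + 1 - p - (i + k), fun t ht => ?_, ?_⟩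
    · rw [hper (i + k + t) (by omega) (by omega)]
      congr 1
      omega
    · rwa [show i + k + p + (j + 1 - p - (i + k)) = j + 1 by omega,
        show i + k + (j + 1 - p - (i + k)) = j + 1 - p by omega]
  · obtain ⟨m, hmq, hm, hlt⟩ := hroot q hq hqp
    refine (suffixFrom_lt_iff _ _ _).2 ⟨m, fun t ht => ?_, ?_⟩
    · have h := hm t ht
      rw [hu _ (by omega), hu _ (by omega)] at h
      simpa only [Nat.add_assoc] using h
    · rw [hu _ (by omega), hu _ (by omega)] at hlt
      simpa only [Nat.add_assoc] using hlt

theorem isPeriod_hat_iff {w : ℕ → α} {n i j p : ℕ} (hj : j ≤ n) :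
    IsPeriod (hat w n) i j p ↔ IsPeriod w i j p := by
  refine forall_congr' fun k => imp_congr_right fun _ => imp_congr_right fun hk => ?_
  simp [hat, show k ≤ n by omega, show k + p ≤ n by omega]

theorem IsRun.hat_ne {w : ℕ → α} {n i j p : ℕ} (h : IsRun w n i j p) :
    hat w n (j + 1) ≠ hat w n (j + 1 - p) := by
  obtain ⟨hi, hj, hp, hij, -, -, -, hext⟩ := h
  have hle : j + 1 - p ≤ n := by omega
  by_cases hjn : j = n
  · simp [hat, hjn, show n + 1 - p ≤ n by omega]
  · simpa [hat, hle, show j + 1 ≤ n by omega, show j - p < n by omega,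
      show j + 1 - p = j - p + 1 by omega] using
      hext.resolve_left hjn

theorem IsRun.exists_nextSmallerSuffix [LinearOrder (Option α)] {w : ℕ → α} {n i j p : ℕ}
    (h : IsRun w n i j p) :
    ∃ k, i < k ∧ k ≤ i + p ∧ (NextSmallerSuffix (hat w n) k p ∨
      NextSmallerSuffix (OrderDual.toDual ∘ hat w n) k p) := by
  have hne := h.hat_ne
  obtain ⟨hi, hj, hp, hij, hper, hmin, -, -⟩ := h
  rw [← isPeriod_hat_iff hj] at hper
  replace hmin : ∀ q, 1 ≤ q → q < p → ¬ IsPeriod (hat w n) i j q := fun q hq hqp =>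
    mt (isPeriod_hat_iff hj).1 (hmin q hq hqp)
  rcases lt_or_gt_of_ne hne with hlt | hgt
  · obtain ⟨k, hk, hkp, hroot⟩ := _root_.exists_nextSmallerSuffix hp hij hper hmin hlt
    exact ⟨k, hk, hkp, .inl hroot⟩
  · obtain ⟨k, hk, hkp, hroot⟩ := _root_.exists_nextSmallerSuffix
      (s := OrderDual.toDual ∘ hat w n) hp hij hper hmin hgt
    exact ⟨k, hk, hkp, .inr hroot⟩

/-- Two runs with the same period overlapping in at least one period coincide. -/
theorem IsRun.eq_of_overlap {w : ℕ → α} {n i j i' j' p k : ℕ} (h : IsRun w n i j p)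
    (h' : IsRun w n i' j' p) (hk : i < k) (hkp : k ≤ i + p) (hk' : i' < k)
    (hkp' : k ≤ i' + p) : i = i' ∧ j = j' := by
  wlog hii : i ≤ i' generalizing i j i' j'
  · exact (this h' h hk' hkp' hk hkp (by omega)).imp Eq.symm Eq.symm
  obtain ⟨hi, hj, hp, hij, hper, -, -, hr⟩ := h
  obtain ⟨hi', hj', -, hij', hper', -, hl', hr'⟩ := h'
  constructor
  · by_contra hne
    refine hl'.resolve_left (by omega) ?_
    rw [hper (i' - 1) (by omega) (by omega)]
    congr 1
    omega
  · rcases lt_trichotomy j j' with hlt | heq | hgt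
    · refine absurd ?_ (hr.resolve_left (by omega))
      rw [hper' (j - p + 1) (by omega) (by omega)]
      congr 1
      omega
    · exact heq
    · refine absurd ?_ (hr'.resolve_left (by omega))
      rw [hper (j' - p + 1) (by omega) (by omega)]
      congr 1
      omega

theorem IsRun.hat_eq {w : ℕ → α} {n i j p k : ℕ} (h : IsRun w n i j p) (hk : i ≤ k)
    (hkp : k < i + p) : hat w n k = hat w n (k + p) := by
  obtain ⟨hi, hj, hp, hij, hper, -⟩ := h
  exact (isPeriod_hat_iff hj).2 hper k hk (by omega)

theorem runs_stmt5 {α : Type*} (n : ℕ) (hn : 1 ≤ n) (w : ℕ → α) :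
    (Runs w n).ncard ≤ n - 1 := by
  classical
  let _ : LinearOrder (Option α) := linearOrderOfSTO WellOrderingRel
  have hex : ∀ r ∈ Runs w n, ∃ k, r.1 < k ∧ k ≤ r.1 + r.2.2 ∧
      (NextSmallerSuffix (hat w n) k r.2.2 ∨
        NextSmallerSuffix (OrderDual.toDual ∘ hat w n) k r.2.2) :=
    fun r hr => IsRun.exists_nextSmallerSuffix hr
  choose! f hf hfp hroot using hex
  have hmaps : ∀ r ∈ Runs w n, f r ∈ (Finset.Icc 2 n : Set ℕ) := fun r hr => by
    have h₁ := hf r hr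
    have h₂ := hfp r hr
    obtain ⟨hi, hj, hp, hij, -⟩ := hr
    rw [Finset.coe_Icc, Set.mem_Icc]
    omega
  have hinj : Set.InjOn f (Runs w n) := by
    rintro ⟨i, j, p⟩ hr ⟨i', j', p'⟩ hr' heq
    have hk := hf _ hr
    have hkp := hfp _ hr
    have hR := hroot _ hr
    have hk' := hf _ hr'
    have hkp' := hfp _ hr'
    have hR' := hroot _ hr'
    rw [← heq] at hk' hkp' hR'
    obtain ⟨k, hfk⟩ : ∃ k, f (i, j, p) = k + 1 := ⟨f (i, j, p) - 1, by dsimp only at hk; omega⟩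
    rw [hfk] at hk hkp hR hk' hkp' hR'
    dsimp only at hk hkp hR hk' hkp' hR'
    change IsRun w n i j p at hr
    change IsRun w n i' j' p' at hr'
    have hp : 0 < p := hr.2.2.1
    have hp' : 0 < p' := hr'.2.2.1
    have hs := hr.hat_eq (k := k) (by omega) (by omega)
    have hs' := hr'.hat_eq (k := k) (by omega) (by omega)
    obtain rfl : p = p' := by
      rcases hR with hR | hR <;> rcases hR' with hR' | hR'
      · exact hR.unique hp hp' hR'
      · exact (hR.not_toDual hp hp' hR' hs hs').elim
      · exact (hR'.not_toDual hp' hp hR hs' hs).elim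
      · exact hR.unique hp hp' hR'
    obtain ⟨rfl, rfl⟩ := hr.eq_of_overlap hr' hk hkp hk' hkp'
    rfl
  calc (Runs w n).ncard ≤ (Finset.Icc 2 n : Set ℕ).ncard :=
        Set.ncard_le_ncard_of_injOn f hmaps hinj (Finset.finite_toSet _)
    _ = n - 1 := by
      rw [Set.ncard_coe_finset, Nat.card_Icc]
      omega
end

section
/- For every string w of length n ≥ 1, the sum of the exponents of all runs of w is at most 3n − 3; in particular, the maximum sum of exponents σ(n) of runs in a string of length n satisfies σ(n) ≤ 3n − 3. -/
variable {α : Type*}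

/-- The factor of length `p` starting at position `k` of `w` is a Lyndon word for `r`
(each proper suffix is larger and is not a prefix of the factor). -/
def LyndonAt {α : Type*} (r : α → α → Prop) (w : ℕ → α) (k p : ℕ) : Prop :=
  ∀ d, 0 < d → d < p → ∃ t, t + d < p ∧ (∀ s < t, w (k + s) = w (k + d + s)) ∧
    r (w (k + t)) (w (k + d + t))

/-- A periodic infinite word with smallest period `p` has a Lyndon factor of length `p`. -/
theorem exists_lyndonAt_of_periodic {α : Type*} (r : α → α → Prop) [IsStrictTotalOrder α r]
    (x : ℕ → α) (p : ℕ) (hp : 0 < p) (hx : ∀ t, x (t + p) = x t)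
    (hmin : ∀ d, 0 < d → d < p → ∃ t, x t ≠ x (t + d)) :
    ∃ c, 1 ≤ c ∧ c ≤ p ∧ LyndonAt r x c p := by
  classical
  let : LinearOrder α := linearOrderOfSTO r
  let f : ℕ → Lex (ℕ → α) := fun c => toLex fun t => x (c + t)
  have hf : ∀ c, f (c + p) = f c := fun c => by
    simp only [f]
    congr 1
    funext t
    rw [add_right_comm, hx]
  obtain ⟨c, hc, hcmin⟩ := Finset.exists_min_image (Finset.Icc 1 p) f ⟨1, by simp; omega⟩
  rw [Finset.mem_Icc] at hc
  have hcmin' : ∀ e, c ≤ e → e ≤ c + p → f c ≤ f e := by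
    intro e he1 he2
    by_cases h : e ≤ p
    · exact hcmin e (Finset.mem_Icc.2 ⟨by omega, h⟩)
    · have := hcmin (e - p) (Finset.mem_Icc.2 ⟨by omega, by omega⟩)
      rwa [← hf (e - p), Nat.sub_add_cancel (by omega)] at this
  have hxm : ∀ m t, x (t + m * p) = x t := by
    intro m
    induction m with
    | zero => simp
    | succ m ih => intro t; rw [Nat.succ_mul, ← add_assoc, hx, ih]
  refine ⟨c, hc.1, hc.2, fun d hd hdp => ?_⟩
  have hne : f c ≠ f (c + d) := by
    intro h
    obtain ⟨t, ht⟩ := hmin d hd hdp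
    apply ht
    have h1 : ∀ s, x (c + s) = x (c + d + s) := fun s => congrFun h s
    have hcm : c ≤ c * p := Nat.le_mul_of_pos_right c hp
    have h2 := h1 (t + c * p - c)
    rw [show c + (t + c * p - c) = t + c * p by omega,
      show c + d + (t + c * p - c) = t + d + c * p by omega, hxm, hxm] at h2
    exact h2
  obtain ⟨t, ht, htlt⟩ := lt_of_le_of_ne (hcmin' (c + d) (by omega) (by omega)) hne
  have ht' : ∀ s < t, x (c + s) = x (c + d + s) := ht
  have htlt' : x (c + t) < x (c + d + t) := htlt
  by_cases htd : t + d < p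
  · exact ⟨t, htd, ht', htlt'⟩
  · exfalso
    refine absurd (hcmin' (c + (p - d)) (by omega) (by omega)) (not_le.2 ?_)
    refine ⟨t - (p - d), fun s hs => ?_, ?_⟩
    · change x (c + (p - d) + s) = x (c + s)
      rw [add_assoc, ht' _ (by omega), ← hx (c + s)]
      congr 1; omega
    · change x (c + (p - d) + (t - (p - d))) < x (c + (t - (p - d)))
      rw [← hx (c + (t - (p - d))), show c + (p - d) + (t - (p - d)) = c + t by omega,
        show c + (t - (p - d)) + p = c + d + t by omega]
      exact htlt'

/-- The letters of a Lyndon word are at least its first letter. -/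
theorem LyndonAt.not_lt_first {α : Type*} {r : α → α → Prop} [IsStrictTotalOrder α r]
    {w : ℕ → α} {k p : ℕ} (h : LyndonAt r w k p) {d : ℕ} (hd : d < p) :
    ¬ r (w (k + d)) (w k) := by
  rcases Nat.eq_zero_or_pos d with rfl | h0
  · exact irrefl _
  obtain ⟨t, -, heq, hlt⟩ := h d h0 hd
  rcases Nat.eq_zero_or_pos t with rfl | ht
  · exact asymm hlt
  · have := heq 0 ht
    simp only [add_zero] at this
    rw [← this]
    exact irrefl _

/-- The first letter of a Lyndon word of length at least two is smaller than the last one. -/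
theorem LyndonAt.first_lt_last {α : Type*} {r : α → α → Prop} {w : ℕ → α} {k p : ℕ}
    (h : LyndonAt r w k p) (hp : 1 < p) : r (w k) (w (k + p - 1)) := by
  obtain ⟨t, ht, -, hlt⟩ := h (p - 1) (by omega) (by omega)
  obtain rfl : t = 0 := by omega
  rwa [add_zero, add_zero, ← Nat.add_sub_assoc hp.le] at hlt

open Classical in
/-- The order, `r` or its converse, for which the letter following the run `(i,j,p)` is smaller
than the letter one period before. -/
noncomputable def runOrder {α : Type*} (r : α → α → Prop) (w : ℕ → α) (n : ℕ)
    (ρ : ℕ × ℕ × ℕ) : α → α → Prop :=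
  fun a b => if ρ.2.1 = n ∨ r (w (ρ.2.1 + 1)) (w (ρ.2.1 - ρ.2.2 + 1)) then r a b else r b a

theorem runOrder_eq_or_swap {α : Type*} (r : α → α → Prop) (w : ℕ → α) (n : ℕ)
    (ρ : ℕ × ℕ × ℕ) : runOrder r w n ρ = r ∨ runOrder r w n ρ = Function.swap r := by
  unfold runOrder
  by_cases h : ρ.2.1 = n ∨ r (w (ρ.2.1 + 1)) (w (ρ.2.1 - ρ.2.2 + 1))
  · left; simp only [if_pos h]
  · right; simp only [if_neg h]

theorem isStrictTotalOrder_swap {α : Type*} (r : α → α → Prop) [IsStrictTotalOrder α r] :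
    IsStrictTotalOrder α (Function.swap r) where
  trichotomous a b h1 h2 := Std.Trichotomous.trichotomous (r := r) a b h2 h1
  irrefl a := irrefl_of r a
  trans _ _ _ h1 h2 := trans_of r h2 h1

theorem isStrictTotalOrder_runOrder {α : Type*} (r : α → α → Prop) [IsStrictTotalOrder α r]
    (w : ℕ → α) (n : ℕ) (ρ : ℕ × ℕ × ℕ) : IsStrictTotalOrder α (runOrder r w n ρ) := by
  rcases runOrder_eq_or_swap r w n ρ with h | h <;> rw [h]
  · infer_instance
  · exact isStrictTotalOrder_swap r

theorem runOrder_next {α : Type*} (r : α → α → Prop) [IsStrictTotalOrder α r] (w : ℕ → α)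
    (n i j p : ℕ) (h : IsRun w n i j p) (hj : j < n) :
    runOrder r w n (i, j, p) (w (j + 1)) (w (j - p + 1)) := by
  obtain ⟨-, -, -, -, -, -, -, hr⟩ := h
  have hne : w (j + 1) ≠ w (j - p + 1) := hr.resolve_left hj.ne
  unfold runOrder
  split_ifs with hc
  · exact hc.resolve_left hj.ne
  · rcases trichotomous_of r (w (j + 1)) (w (j - p + 1)) with h | h | h
    · exact absurd (Or.inr h) hc
    · exact absurd h hne
    · exact h

open Classical in
/-- Starting positions, other than the first position, of the Lyndon roots of a run. -/
noncomputable def rootStarts {α : Type*} (r : α → α → Prop) (w : ℕ → α) (n : ℕ)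
    (ρ : ℕ × ℕ × ℕ) : Finset ℕ :=
  (Finset.Icc 2 n).filter fun k => ρ.1 < k ∧ k + ρ.2.2 ≤ ρ.2.1 + 1 ∧
    LyndonAt (runOrder r w n ρ) w k ρ.2.2

/-- Two runs of equal period overlapping in at least one period plus one letter coincide. -/
theorem isRun_unique_of_overlap {α : Type*} {w : ℕ → α} {n i j i' j' p k : ℕ}
    (h : IsRun w n i j p) (h' : IsRun w n i' j' p)
    (hik : i < k) (hkj : k + p ≤ j + 1) (hik' : i' < k) (hkj' : k + p ≤ j' + 1) :
    i = i' ∧ j = j' := by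
  have key : ∀ {i j i' j' : ℕ}, IsRun w n i j p → IsRun w n i' j' p → i < k → k + p ≤ j + 1 →
      i' < k → k + p ≤ j' + 1 → i ≤ i' ∧ j' ≤ j := by
    intro i j i' j' h h' hik hkj hik' hkj'
    obtain ⟨h1, h2, h3, h4, h5, h6, h7, h8⟩ := h
    obtain ⟨g1, g2, g3, g4, g5, g6, g7, g8⟩ := h'
    constructor
    · by_contra! hlt
      refine h7.resolve_left (by omega) ?_
      rw [g5 (i - 1) (by omega) (by omega)]
      congr 1; omega
    · by_contra! hlt
      refine h8.resolve_left (by omega) ?_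
      rw [g5 (j - p + 1) (by omega) (by omega)]
      congr 1; omega
  have a := key h h' hik hkj hik' hkj'
  have b := key h' h hik' hkj' hik hkj
  omega

/-- A position cannot start Lyndon roots of two runs with different periods. -/
theorem not_lyndonAt_of_period_lt {α : Type*} (r : α → α → Prop) [IsStrictTotalOrder α r]
    {w : ℕ → α} {n i j p i' j' p' k : ℕ}
    (h : IsRun w n i j p) (h' : IsRun w n i' j' p') (hpp : p < p')
    (hik : i < k) (hkj : k + p ≤ j + 1) (hik' : i' < k) (hkj' : k + p' ≤ j' + 1)
    (hL : LyndonAt (runOrder r w n (i, j, p)) w k p) :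
    ¬ LyndonAt (runOrder r w n (i', j', p')) w k p' := by
  intro hL'
  have := isStrictTotalOrder_runOrder r w n (i, j, p)
  have := isStrictTotalOrder_runOrder r w n (i', j', p')
  have hnext := runOrder_next r w n i j p h
  obtain ⟨h1, h2, h3, h4, h5, -⟩ := h
  obtain ⟨g1, g2, g3, g4, g5, -⟩ := h'
  have hlast' := hL'.first_lt_last (by omega)
  by_cases hord : runOrder r w n (i, j, p) = runOrder r w n (i', j', p')
  · obtain ⟨t, ht, heq, hlt⟩ := hL' p (by omega) hpp
    by_cases htj : k + p + t ≤ j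
    · rw [h5 (k + t) (by omega) (by omega), add_right_comm k t p] at hlt
      exact irrefl _ hlt
    · have hnx := hnext (by omega)
      rw [hord] at hnx
      rcases (show j + 1 ≤ k + p + t by omega).eq_or_lt with he | hl
      · rw [← he, show k + t = j - p + 1 by omega] at hlt
        exact asymm hlt hnx
      · have := heq (j + 1 - (k + p)) (by omega)
        rw [show k + (j + 1 - (k + p)) = j - p + 1 by omega,
          show k + p + (j + 1 - (k + p)) = j + 1 by omega] at this
        rw [this] at hnx
        exact irrefl _ hnx
  · have hswap : ∀ a b, runOrder r w n (i, j, p) a b → runOrder r w n (i', j', p') b a := by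
      intro a b hab
      rcases runOrder_eq_or_swap r w n (i, j, p) with e | e <;>
        rcases runOrder_eq_or_swap r w n (i', j', p') with e' | e' <;>
        rw [e] at hab hord <;> rw [e'] at hord ⊢
      · exact absurd rfl hord
      · exact hab
      · exact hab
      · exact absurd rfl hord
    rcases (show 1 ≤ p from h3).eq_or_lt with hp1 | hp1
    · subst hp1
      have e1 := h5 (k - 1) (by omega) (by omega)
      have e2 := g5 (k - 1) (by omega) (by omega)
      rw [show k - 1 + 1 = k by omega] at e1
      rw [show k - 1 + p' = k + p' - 1 by omega] at e2
      rw [← e2, e1] at hlast'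
      exact irrefl _ hlast'
    · have hl := hswap _ _ (hL.first_lt_last hp1)
      rw [Nat.add_sub_assoc hp1.le] at hl
      exact hL'.not_lt_first (by omega) hl

theorem disjoint_rootStarts {α : Type*} (r : α → α → Prop) [IsStrictTotalOrder α r]
    {w : ℕ → α} {n : ℕ} {ρ ρ' : ℕ × ℕ × ℕ} (h : ρ ∈ Runs w n) (h' : ρ' ∈ Runs w n)
    (hne : ρ ≠ ρ') : Disjoint (rootStarts r w n ρ) (rootStarts r w n ρ') := by
  obtain ⟨i, j, p⟩ := ρ
  obtain ⟨i', j', p'⟩ := ρ'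
  rw [Finset.disjoint_left]
  intro k hk hk'
  simp only [rootStarts, Finset.mem_filter] at hk hk'
  obtain ⟨-, h1, h2, h3⟩ := hk
  obtain ⟨-, g1, g2, g3⟩ := hk'
  rcases lt_trichotomy p p' with hp | rfl | hp
  · exact not_lyndonAt_of_period_lt r h h' hp h1 h2 g1 g2 h3 g3
  · obtain ⟨rfl, rfl⟩ := isRun_unique_of_overlap h h' h1 h2 g1 g2
    exact hne rfl
  · exact not_lyndonAt_of_period_lt r h' h hp g1 g2 h1 h2 g3 h3

theorem div_le_card_rootStarts {α : Type*} (r : α → α → Prop) [IsStrictTotalOrder α r]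
    {w : ℕ → α} {n i j p : ℕ} (h : IsRun w n i j p) :
    (j + 1 - i) / p - 1 ≤ (rootStarts r w n (i, j, p)).card := by
  obtain ⟨h1, h2, h3, h4, h5, h6, -⟩ := h
  have := isStrictTotalOrder_runOrder r w n (i, j, p)
  have hw : ∀ s, i + s ≤ j → w (i + s) = w (i + s % p) := by
    intro s
    induction s using Nat.strong_induction_on with
    | _ s ih =>
      intro hs
      by_cases hsp : s < p
      · rw [Nat.mod_eq_of_lt hsp]
      · rw [Nat.mod_eq_sub_mod (by omega), ← ih (s - p) (by omega) (by omega),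
          h5 (i + (s - p)) (by omega) (by omega)]
        congr 1; omega
  obtain ⟨c, hc1, hc2, hc⟩ := exists_lyndonAt_of_periodic (runOrder r w n (i, j, p))
    (fun t => w (i + t % p)) p h3 (fun t => by simp) (by
      intro d hd hdp
      by_contra! hall
      refine h6 d hd hdp fun k hik hkj => ?_
      have := hall (k - i)
      rw [← hw _ (by omega), ← hw _ (by omega)] at this
      rwa [show i + (k - i) = k by omega, show i + (k - i + d) = k + d by omega] at this)
  set m := (j + 1 - i) / p with hm
  have hmp : m * p ≤ j + 1 - i := Nat.div_mul_le_self _ _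
  have hinj : Function.Injective fun t : ℕ => i + c + t * p := by
    intro a b hab
    exact Nat.eq_of_mul_eq_mul_right h3 (by simpa using hab)
  calc m - 1 = ((Finset.range (m - 1)).image fun t => i + c + t * p).card := by
        rw [Finset.card_image_of_injective _ hinj, Finset.card_range]
    _ ≤ _ := Finset.card_le_card ?_
  intro k hk
  obtain ⟨t, ht, rfl⟩ := Finset.mem_image.1 hk
  rw [Finset.mem_range] at ht
  have htm : (t + 2) * p ≤ m * p := Nat.mul_le_mul_right p (by omega)
  rw [add_mul] at htm
  have hval : ∀ s < p, w (i + c + t * p + s) = w (i + (c + s) % p) := by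
    intro s hs
    rw [show i + c + t * p + s = i + (c + s + t * p) by ring, hw _ (by omega),
      Nat.add_mul_mod_self_right]
  simp only [rootStarts, Finset.mem_filter, Finset.mem_Icc]
  refine ⟨⟨by omega, by omega⟩, by omega, by omega, fun d hd hdp => ?_⟩
  obtain ⟨u, hu, heq, hlt⟩ := hc d hd hdp
  refine ⟨u, hu, fun s hs => ?_, ?_⟩
  · rw [hval s (by omega), add_assoc _ d s, hval (d + s) (by omega), ← add_assoc c d s]
    exact heq s hs
  · rw [hval u (by omega), add_assoc _ d u, hval (d + u) (by omega), ← add_assoc c d u]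
    exact hlt

theorem expo_le_three_mul_card_rootStarts {α : Type*} (r : α → α → Prop)
    [IsStrictTotalOrder α r] {w : ℕ → α} {n : ℕ} {ρ : ℕ × ℕ × ℕ} (h : ρ ∈ Runs w n) :
    expo ρ ≤ 3 * ((rootStarts r w n ρ).card : ℚ) := by
  obtain ⟨i, j, p⟩ := ρ
  have hcard := div_le_card_rootStarts r (show IsRun w n i j p from h)
  obtain ⟨h1, h2, h3, h4, -⟩ := h
  simp only at h1 h2 h3 h4
  set s := (rootStarts r w n (i, j, p)).card
  have hm2 : 2 ≤ (j + 1 - i) / p := (Nat.le_div_iff_mul_le h3).2 (by omega)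
  have hlt : j + 1 - i < ((j + 1 - i) / p + 1) * p :=
    Nat.lt_mul_of_div_lt (Nat.lt_succ_self _) h3
  have hle : j + 1 ≤ 3 * s * p + i := by
    have : ((j + 1 - i) / p + 1) * p ≤ 3 * s * p := Nat.mul_le_mul_right p (by omega)
    omega
  have hp : (0 : ℚ) < p := by exact_mod_cast h3
  have hle' : (j : ℚ) + 1 ≤ 3 * s * p + i := by exact_mod_cast hle
  simp only [expo]
  rw [div_le_iff₀ hp]
  linarith

theorem finite_runs {α : Type*} (w : ℕ → α) (n : ℕ) : (Runs w n).Finite := by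
  refine (Finset.finite_toSet
    (Finset.range (n + 2) ×ˢ Finset.range (n + 2) ×ˢ Finset.range (n + 2))).subset ?_
  rintro ⟨i, j, p⟩ ⟨h1, h2, h3, h4, -⟩
  simp only at h1 h2 h3 h4
  simp only [Finset.coe_product, Set.mem_prod, Finset.coe_range, Set.mem_Iio]
  omega

theorem runs_stmt6 {α : Type*} (n : ℕ) (hn : 1 ≤ n) (w : ℕ → α) :
    ∑ᶠ r ∈ Runs w n, expo r ≤ 3 * (n : ℚ) - 3 := by
  classical
  let r : α → α → Prop := WellOrderingRel
  have : IsStrictTotalOrder α r := inferInstanceAs (IsStrictTotalOrder α WellOrderingRel)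
  have hfin := finite_runs w n
  rw [finsum_mem_eq_finite_toFinset_sum _ hfin]
  have hcard : ∑ ρ ∈ hfin.toFinset, (rootStarts r w n ρ).card ≤ n - 1 := by
    rw [← Finset.card_biUnion fun ρ hρ ρ' hρ' hne =>
      disjoint_rootStarts r (hfin.mem_toFinset.1 hρ) (hfin.mem_toFinset.1 hρ') hne]
    calc _ ≤ (Finset.Icc 2 n).card :=
          Finset.card_le_card (Finset.biUnion_subset.2 fun _ _ => Finset.filter_subset _ _)
      _ = n - 1 := by simp
  calc ∑ ρ ∈ hfin.toFinset, expo ρ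
      ≤ ∑ ρ ∈ hfin.toFinset, 3 * ((rootStarts r w n ρ).card : ℚ) :=
        Finset.sum_le_sum fun ρ hρ =>
          expo_le_three_mul_card_rootStarts r (hfin.mem_toFinset.1 hρ)
    _ = 3 * ((∑ ρ ∈ hfin.toFinset, (rootStarts r w n ρ).card : ℕ) : ℚ) := by
        rw [Nat.cast_sum, Finset.mul_sum]
    _ ≤ 3 * ((n - 1 : ℕ) : ℚ) := by gcongr
    _ = 3 * (n : ℚ) - 3 := by rw [Nat.cast_sub hn]; ring
end

section
/- Every string w of length n that contains exactly d distinct symbols has at most n − d runs; in particular, ρ(n,d) ≤ n − d, where ρ(n,d) is the maximum number of runs in a string of length n containing exactly d distinct symbols. -/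
variable {α : Type*}

/-- The suffix of `v` at `a` is lexicographically smaller than the suffix at `b`, and the first
mismatch occurs at an offset smaller than `c`. -/
def SuffixLT {β : Type*} [LT β] (v : ℕ → β) (a b c : ℕ) : Prop :=
  ∃ t, t < c ∧ (∀ u, u < t → v (a + u) = v (b + u)) ∧ v (a + t) < v (b + t)

theorem SuffixLT.asymm {β : Type*} [LinearOrder β] {v : ℕ → β} {a b c c' : ℕ}
    (h : SuffixLT v a b c) (h' : SuffixLT v b a c') : False := by
  obtain ⟨t, -, ht, hlt⟩ := h
  obtain ⟨t', -, ht', hlt'⟩ := h'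
  rcases lt_trichotomy t t' with h | h | h
  · exact absurd (ht' t h) hlt.ne'
  · subst h
    exact lt_asymm hlt hlt'
  · exact absurd (ht t' h) hlt'.ne'

/-- A primitive periodic sequence has a Lyndon rotation starting in any window of length `p`. -/
theorem exists_lyndon_rotation {β : Type*} [LinearOrder β] (x : ℕ → β) (p a : ℕ) (hp : 1 ≤ p)
    (hper : ∀ u, x (u + p) = x u)
    (hprim : ∀ s, 1 ≤ s → s < p → ∃ u, x (u + s) ≠ x u) :
    ∃ k, a ≤ k ∧ k < a + p ∧ ∀ m, k < m → m < k + p → SuffixLT x k m (k + p - m) := by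
  have hperm : ∀ c u, x (u + c * p) = x u := by
    intro c
    induction c with
    | zero => simp
    | succ c ih =>
      intro u
      rw [Nat.succ_mul, ← Nat.add_assoc, hper, ih]
  let X : ℕ → Lex (ℕ → β) := fun k => toLex fun u => x (k + u)
  have hX : ∀ b c, X b < X c ↔ ∃ t, (∀ u, u < t → x (b + u) = x (c + u)) ∧
      x (b + t) < x (c + t) := fun b c => Iff.rfl
  obtain ⟨k, hk, hmin⟩ := Finset.exists_min_image (Finset.Ico a (a + p)) X
    ⟨a, by simp; omega⟩
  rw [Finset.mem_Ico] at hk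
  have hmin' : ∀ m, a ≤ m → X k ≤ X m := by
    intro m hm
    have h1 : X m = X (a + (m - a) % p) := by
      refine congrArg toLex (funext fun u => ?_)
      have h2 : m + u = a + (m - a) % p + u + ((m - a) / p) * p := by
        have := Nat.mod_add_div' (m - a) p
        omega
      rw [h2, hperm]
    rw [h1]
    refine hmin _ (Finset.mem_Ico.2 ⟨by omega, ?_⟩)
    have := Nat.mod_lt (m - a) (show p > 0 by omega)
    omega
  refine ⟨k, hk.1, hk.2, fun m hkm hmk => ?_⟩
  by_cases hdiff : ∃ t, t < k + p - m ∧ x (k + t) ≠ x (m + t)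
  · classical
    obtain ⟨ht, hne⟩ := Nat.find_spec hdiff
    have hagree : ∀ u, u < Nat.find hdiff → x (k + u) = x (m + u) := by
      intro u hu
      have := Nat.find_min hdiff hu
      push Not at this
      exact this (by omega)
    refine ⟨Nat.find hdiff, ht, hagree, lt_of_le_of_ne (not_lt.1 fun hgt => ?_) hne⟩
    exact absurd ((hX m k).2 ⟨_, fun u hu => (hagree u hu).symm, hgt⟩)
      (not_lt.2 (hmin' m (by omega)))
  · exfalso
    push Not at hdiff
    obtain ⟨s, hs⟩ : ∃ s, s = k + p - m := ⟨_, rfl⟩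
    rw [← hs] at hdiff
    have hms : ∀ u, x (m + (s + u)) = x (k + u) := by
      intro u
      rw [show m + (s + u) = k + u + p by omega, hper]
    have hle : X (k + s) ≤ X k := by
      refine not_lt.1 fun hlt => ?_
      obtain ⟨t, ht, hlt⟩ := (hX _ _).1 hlt
      refine absurd ((hX m k).2 ⟨s + t, fun u hu => ?_, ?_⟩) (not_lt.2 (hmin' m (by omega)))
      · by_cases hus : u < s
        · exact (hdiff u hus).symm
        · obtain ⟨u', rfl⟩ := Nat.exists_eq_add_of_le (not_lt.1 hus)
          rw [hms, ht u' (by omega), Nat.add_assoc]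
      · rw [hms, ← Nat.add_assoc]
        exact hlt
    have heq := le_antisymm hle (hmin' (k + s) (by omega))
    obtain ⟨u, hu⟩ := hprim s (by omega) (by omega)
    have h1 : k ≤ k * p := Nat.le_mul_of_pos_right k (by omega)
    have h2 : x (k + s + (u + (k * p - k))) = x (k + (u + (k * p - k))) :=
      congrFun (toLex.injective heq) _
    rw [show k + s + (u + (k * p - k)) = u + s + k * p by omega,
      show k + (u + (k * p - k)) = u + k * p by omega, hperm, hperm] at h2
    exact hu h2

/-- Position `k` starts, not at the left end of `v[i..j]`, a factor of length `p` that is Lyndon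
for the order in which the letter breaking the period is smaller than the expected one. -/
def IsRootStart {β : Type*} [LT β] (v : ℕ → β) (i j p k : ℕ) : Prop :=
  v (j + 1) < v (j + 1 - p) ∧ i + 1 ≤ k ∧ k ≤ i + p ∧
    ∀ m, k < m → m < k + p → SuffixLT v k m (k + p - m)

theorem IsRun.exists_isRootStart {β : Type*} [LinearOrder β] {v : ℕ → β} {n i j p : ℕ}
    (h : IsRun v n i j p) (hlt : v (j + 1) < v (j + 1 - p)) : ∃ k, IsRootStart v i j p k := by
  obtain ⟨-, -, hp, hij, hper, hprim, -, -⟩ := h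
  have hx : ∀ u, i + u ≤ j → v (i + u % p) = v (i + u) := by
    intro u
    induction u using Nat.strong_induction_on with
    | _ u ih =>
      intro hu
      by_cases hup : u < p
      · rw [Nat.mod_eq_of_lt hup]
      · rw [Nat.mod_eq_sub_mod (not_lt.1 hup), ih (u - p) (by omega) (by omega),
          hper (i + (u - p)) (by omega) (by omega)]
        congr 1
        omega
  obtain ⟨k, hk1, hkp, hk⟩ := exists_lyndon_rotation (fun u => v (i + u % p)) p 1 hp
    (fun u => by simp) (by
      intro s hs hsp
      by_contra! hall
      refine hprim s hs hsp fun k hik hkj => ?_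
      have := hall (k - i)
      rw [hx _ (by omega), hx _ (by omega)] at this
      rw [show k + s = i + (k - i + s) by omega, this]
      congr 1
      omega)
  refine ⟨i + k, hlt, by omega, by omega, fun m hm hmp => ?_⟩
  obtain ⟨t, ht, hagree, hlt⟩ := hk (m - i) (by omega) (by omega)
  refine ⟨t, by omega, fun u hu => ?_, ?_⟩
  · have := hagree u hu
    simp only at this
    rw [hx _ (by omega), hx _ (by omega)] at this
    rw [show i + k + u = i + (k + u) by omega, this]
    congr 1
    omega
  · simp only at hlt
    rw [hx _ (by omega), hx _ (by omega)] at hlt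
    rwa [show i + k + t = i + (k + t) by omega, show m + t = i + (m - i + t) by omega]

theorem IsRun.suffixLT {β : Type*} [LinearOrder β] {v : ℕ → β} {n i j p k : ℕ}
    (h : IsRun v n i j p) (hk : IsRootStart v i j p k) :
    SuffixLT v (k + p) k (j + 2) := by
  obtain ⟨-, -, hp, hij, hper, -⟩ := h
  obtain ⟨hlt, h1, h2, -⟩ := hk
  refine ⟨j + 1 - p - k, by omega, fun u hu => ?_, ?_⟩
  · rw [hper (k + u) (by omega) (by omega)]
    congr 1
    omega
  · rwa [show k + p + (j + 1 - p - k) = j + 1 by omega,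
      show k + (j + 1 - p - k) = j + 1 - p by omega]

/-- Two runs with the same period and a common window of that length coincide. -/
theorem IsRun.eq_of_common_window {β : Type*} {v : ℕ → β} {n i j i' j' p k : ℕ}
    (h : IsRun v n i j p) (h' : IsRun v n i' j' p)
    (hi : i < k) (hi' : i' < k) (hki : k ≤ i + p) (hki' : k ≤ i' + p) :
    i = i' ∧ j = j' := by
  obtain ⟨a1, a2, a3, a4, a5, -, a7, a8⟩ := h
  obtain ⟨b1, b2, b3, b4, b5, -, b7, b8⟩ := h'
  constructor
  · rcases lt_trichotomy i i' with hlt | heq | hlt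
    · refine absurd (a5 (i' - 1) (by omega) (by omega)) ?_
      rw [show i' - 1 + p = i' + p - 1 by omega]
      exact b7.resolve_left (by omega)
    · exact heq
    · refine absurd (b5 (i - 1) (by omega) (by omega)) ?_
      rw [show i - 1 + p = i + p - 1 by omega]
      exact a7.resolve_left (by omega)
  · rcases lt_trichotomy j j' with hlt | heq | hlt
    · refine absurd (b5 (j - p + 1) (by omega) (by omega)) ?_
      rw [show j - p + 1 + p = j + 1 by omega]
      exact (a8.resolve_left (by omega)).symm
    · exact heq
    · refine absurd (a5 (j' - p + 1) (by omega) (by omega)) ?_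
      rw [show j' - p + 1 + p = j' + 1 by omega]
      exact (b8.resolve_left (by omega)).symm

theorem IsRootStart.eq {β : Type*} [LinearOrder β] {v : ℕ → β} {n i j p i' j' p' k : ℕ}
    (h : IsRun v n i j p) (h' : IsRun v n i' j' p')
    (hk : IsRootStart v i j p k) (hk' : IsRootStart v i' j' p' k) :
    i = i' ∧ j = j' ∧ p = p' := by
  have hp := h.2.2.1
  have hp' := h'.2.2.1
  rcases lt_trichotomy p p' with hlt | rfl | hlt
  · exact ((h.suffixLT hk).asymm (hk'.2.2.2 (k + p) (by omega) (by omega))).elim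
  · obtain ⟨h1, h2⟩ := h.eq_of_common_window h' hk.2.1 hk'.2.1 hk.2.2.1 hk'.2.2.1
    exact ⟨h1, h2, rfl⟩
  · exact ((h'.suffixLT hk').asymm (hk.2.2.2 (k + p') (by omega) (by omega))).elim

/-- The letter before a root start of a run of period at least two differs from the letter at it. -/
theorem IsRootStart.pred_ne {β : Type*} [LinearOrder β] {v : ℕ → β} {n i j p k : ℕ}
    (h : IsRun v n i j p) (hk : IsRootStart v i j p k) (hp : 2 ≤ p) : v (k - 1) ≠ v k := by
  obtain ⟨-, -, -, hij, hper, -⟩ := h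
  obtain ⟨-, h1, h2, h3⟩ := hk
  obtain ⟨t, ht, -, hlt⟩ := h3 (k + p - 1) (by omega) (by omega)
  obtain rfl : t = 0 := by omega
  have := hper (k - 1) (by omega) (by omega)
  rw [this, show k - 1 + p = k + p - 1 by omega]
  exact hlt.ne'

theorem IsRun.pred_eq_of_period_one {β : Type*} {v : ℕ → β} {n i j k : ℕ}
    (h : IsRun v n i j 1) (h1 : i + 1 ≤ k) (h2 : k ≤ i + 1) : v (k - 1) = v k := by
  obtain ⟨-, -, -, hij, hper, -⟩ := h
  have := hper (k - 1) (by omega) (by omega)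
  rwa [show k - 1 + 1 = k by omega] at this

theorem suffixLT_neg {v : ℕ → ℤ} {a b c : ℕ} :
    SuffixLT (fun x => -v x) a b c ↔ SuffixLT v b a c := by
  constructor
  · rintro ⟨t, ht, h1, h2⟩
    exact ⟨t, ht, fun u hu => by have := h1 u hu; simp only at this; omega,
      by simp only at h2; omega⟩
  · rintro ⟨t, ht, h1, h2⟩
    exact ⟨t, ht, fun u hu => by have := h1 u hu; simp only; omega, by simp only; omega⟩

theorem IsRun.congr {β γ : Type*} {v : ℕ → β} {v' : ℕ → γ} {n i j p : ℕ}
    (hv : ∀ x y, x ≤ n → y ≤ n → (v x = v y ↔ v' x = v' y)) (h : IsRun v n i j p) :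
    IsRun v' n i j p := by
  obtain ⟨a1, a2, a3, a4, a5, a6, a7, a8⟩ := h
  refine ⟨a1, a2, a3, a4, fun k h1 h2 => (hv _ _ (by omega) (by omega)).1 (a5 k h1 h2),
    fun q h1 h2 h3 => a6 q h1 h2 fun k h4 h5 => (hv _ _ (by omega) (by omega)).2 (h3 k h4 h5),
    a7.imp_right fun h => ?_, or_iff_not_imp_left.2 fun hj => ?_⟩
  · rwa [Ne, ← hv _ _ (by omega) (by omega)]
  · have := a8.resolve_left hj
    rwa [Ne, ← hv _ _ (by omega) (by omega)]

/-- Root starts for an order and for the reverse order belong to different positions. -/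
theorem IsRootStart.not_isRootStart_neg {v : ℕ → ℤ} {n i j p i' j' p' k : ℕ}
    (h : IsRun v n i j p) (h' : IsRun v n i' j' p')
    (hk : IsRootStart v i j p k) (hk' : IsRootStart (fun x => -v x) i' j' p' k) : False := by
  have hneg : IsRun (fun x => -v x) n i' j' p' := h'.congr (by intros; simp)
  have hp := h.2.2.1
  have hp' := h'.2.2.1
  have hs := h.suffixLT hk
  have hs' := suffixLT_neg.1 (hneg.suffixLT hk')
  by_cases hp2 : 2 ≤ p
  · by_cases hp2' : 2 ≤ p'
    · exact (hk.2.2.2 (k + 1) (by omega) (by omega)).asymm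
        (suffixLT_neg.1 (hk'.2.2.2 (k + 1) (by omega) (by omega)))
    · obtain rfl : p' = 1 := by omega
      exact hk.pred_ne h hp2 (h'.pred_eq_of_period_one hk'.2.1 hk'.2.2.1)
  · obtain rfl : p = 1 := by omega
    by_cases hp2' : 2 ≤ p'
    · exact hk'.pred_ne hneg hp2' (congrArg Neg.neg (h.pred_eq_of_period_one hk.2.1 hk.2.2.1))
    · obtain rfl : p' = 1 := by omega
      exact hs.asymm hs'

open Classical in
/-- The last position in `[0..n]` carrying the letter `w x`; positions beyond `n` are pairwise
distinct sentinels. -/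
noncomputable def lastOcc (w : ℕ → α) (n x : ℕ) : ℕ :=
  if x ≤ n then Nat.findGreatest (fun y => w y = w x) n else x

theorem le_lastOcc (w : ℕ → α) (n x : ℕ) : x ≤ lastOcc w n x := by
  unfold lastOcc
  split_ifs with h
  · classical
    exact Nat.le_findGreatest h rfl
  · exact le_rfl

theorem lastOcc_le (w : ℕ → α) {n x : ℕ} (h : x ≤ n) : lastOcc w n x ≤ n := by
  classical
  rw [lastOcc, if_pos h]
  exact Nat.findGreatest_le n

theorem apply_lastOcc (w : ℕ → α) {n x : ℕ} (h : x ≤ n) : w (lastOcc w n x) = w x := by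
  classical
  rw [lastOcc, if_pos h]
  exact Nat.findGreatest_spec (P := fun y => w y = w x) h rfl

theorem lastOcc_eq_iff (w : ℕ → α) {n x y : ℕ} (hx : x ≤ n) (hy : y ≤ n) :
    lastOcc w n x = lastOcc w n y ↔ w x = w y := by
  constructor
  · intro h
    rw [← apply_lastOcc w hx, h, apply_lastOcc w hy]
  · intro h
    rw [lastOcc, lastOcc, if_pos hx, if_pos hy, h]

/-- Position `s` starts the maximal block of equal letters containing the last occurrence
of its letter. -/
def IsLastBlockStart (w : ℕ → α) (n s : ℕ) : Prop :=
  1 ≤ s ∧ s ≤ n ∧ (s = 1 ∨ w (s - 1) ≠ w s) ∧ ∀ u, s ≤ u → u ≤ lastOcc w n s → w u = w s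

theorem exists_isLastBlockStart (w : ℕ → α) {n x : ℕ} (h1 : 1 ≤ x) (hx : x ≤ n) :
    ∃ s, IsLastBlockStart w n s ∧ w s = w x := by
  classical
  have hle := le_lastOcc w n x
  have hle' := lastOcc_le w hx
  have hex : ∃ s, 1 ≤ s ∧ s ≤ lastOcc w n x ∧ ∀ u, s ≤ u → u ≤ lastOcc w n x → w u = w x :=
    ⟨lastOcc w n x, by omega, le_rfl, fun u h2 h3 => by
      rw [le_antisymm h3 h2, apply_lastOcc w hx]⟩
  obtain ⟨a1, a2, a3⟩ := Nat.find_spec hex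
  have hmin : ∀ m, m < Nat.find hex → _ := fun m hm => Nat.find_min hex hm
  generalize Nat.find hex = s at *
  have hsx : w s = w x := a3 s le_rfl a2
  refine ⟨s, ⟨a1, by omega, or_iff_not_imp_left.2 fun hs heq => ?_, fun u h2 h3 => ?_⟩, hsx⟩
  · refine hmin (s - 1) (by omega) ⟨by omega, by omega, fun u h2 h3 => ?_⟩
    by_cases hu : u = s - 1
    · rw [hu, heq, hsx]
    · exact a3 u (by omega) h3
  · rw [(lastOcc_eq_iff w (by omega) hx).2 hsx] at h3
    rw [hsx, a3 u h2 h3]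

/-- A run whose root start is the start of the last block of a letter has period at least two,
and that block ends strictly inside the root. -/
theorem IsLastBlockStart.lastOcc_lt {β : Type*} [LinearOrder β] {w : ℕ → α} {v : ℕ → β}
    {n i j p s : ℕ} (hv : ∀ x y, x ≤ n → y ≤ n → (v x = v y ↔ w x = w y))
    (h : IsRun v n i j p) (hk : IsRootStart v i j p s) (hs : IsLastBlockStart w n s) :
    lastOcc w n s + 1 < s + p ∧ 2 ≤ p ∧ j + 1 = s + p := by
  obtain ⟨h1, h2, h3, h4⟩ := hs
  have hle := le_lastOcc w n s
  have hle' := lastOcc_le w h2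
  have hp : 2 ≤ p := by
    by_contra hp
    obtain rfl : p = 1 := by have := h.2.2.1; omega
    have := h.pred_eq_of_period_one hk.2.1 hk.2.2.1
    rw [hv _ _ (by omega) h2] at this
    have hi := h.1
    have := hk.2.1
    rcases h3 with h3 | h3
    · omega
    · contradiction
  obtain ⟨a1, a2, -, a4, a5, -⟩ := h
  obtain ⟨-, b1, b2, b3⟩ := hk
  have hlt : lastOcc w n s + 1 < s + p := by
    by_contra hge
    obtain ⟨t, ht, -, hlt⟩ := b3 (s + 1) (by omega) (by omega)
    refine hlt.ne ((hv _ _ (by omega) (by omega)).2 ?_)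
    rw [h4 (s + t) (by omega) (by omega), h4 (s + 1 + t) (by omega) (by omega)]
  refine ⟨hlt, hp, ?_⟩
  by_contra hne
  have := (hv _ _ (by omega) (by omega)).1 (a5 s (by omega) (by omega))
  rw [← lastOcc_eq_iff w h2 (by omega : s + p ≤ n)] at this
  have := le_lastOcc w n (s + p)
  omega

theorem IsLastBlockStart.not_isRootStart {w : ℕ → α} {n i j p s : ℕ}
    (h : IsRun w n i j p) (hs : IsLastBlockStart w n s) :
    ¬ IsRootStart (fun x => (lastOcc w n x : ℤ)) i j p s ∧
    ¬ IsRootStart (fun x => -(lastOcc w n x : ℤ)) i j p s := by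
  constructor
  · intro hk
    have hv : ∀ x y, x ≤ n → y ≤ n →
        (((lastOcc w n x : ℤ)) = (lastOcc w n y : ℤ) ↔ w x = w y) := by
      intro x y hx hy
      rw [← lastOcc_eq_iff w hx hy]
      simp
    obtain ⟨h1, h2, h3⟩ := hs.lastOcc_lt hv (h.congr fun x y hx hy => (hv x y hx hy).symm) hk
    have h4 := hk.1
    have := le_lastOcc w n (j + 1)
    simp only [show j + 1 - p = s by omega] at h4
    omega
  · intro hk
    have hv : ∀ x y, x ≤ n → y ≤ n →
        (-((lastOcc w n x : ℤ)) = -(lastOcc w n y : ℤ) ↔ w x = w y) := by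
      intro x y hx hy
      rw [← lastOcc_eq_iff w hx hy]
      simp
    obtain ⟨h1, h2, h3⟩ := hs.lastOcc_lt hv (h.congr fun x y hx hy => (hv x y hx hy).symm) hk
    have hle := le_lastOcc w n s
    obtain ⟨t, -, h4, h5⟩ := hk.2.2.2 (lastOcc w n s + 1) (by omega) (by omega)
    have hle' := le_lastOcc w n (lastOcc w n s + 1)
    rcases Nat.eq_zero_or_pos t with rfl | ht
    · simp only [Nat.add_zero] at h5
      omega
    · have := h4 0 ht
      simp only [Nat.add_zero] at this
      omega

theorem runs_stmt9 {α : Type*} (n d : ℕ) (w : ℕ → α)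
    (hd : {a : α | ∃ i, 1 ≤ i ∧ i ≤ n ∧ w i = a}.ncard = d) :
    (Runs w n).ncard ≤ n - d := by
  let v : ℕ → ℤ := fun x => (lastOcc w n x : ℤ)
  let F : Set ℕ := {s | IsLastBlockStart w n s}
  have hFsub : F ⊆ Set.Icc 1 n := fun s hs => ⟨hs.1, hs.2.1⟩
  have hFfin : F.Finite := (Set.finite_Icc 1 n).subset hFsub
  have hdF : d ≤ F.ncard := by
    rw [← hd]
    refine le_trans (Set.ncard_le_ncard ?_ (hFfin.image w)) (Set.ncard_image_le hFfin)
    rintro a ⟨x, h1, hx, rfl⟩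
    exact exists_isLastBlockStart w h1 hx
  have hv : ∀ {i j p}, IsRun w n i j p → IsRun v n i j p := fun h =>
    h.congr fun x y hx hy => by simp [v, lastOcc_eq_iff w hx hy]
  have hnv : ∀ {i j p}, IsRun w n i j p → IsRun (fun x => -v x) n i j p := fun h =>
    (hv h).congr (by intros; simp)
  have hex : ∀ r ∈ Runs w n, ∃ k, IsRootStart v r.1 r.2.1 r.2.2 k ∨
      IsRootStart (fun x => -v x) r.1 r.2.1 r.2.2 k := by
    rintro ⟨i, j, p⟩ (hr : IsRun w n i j p)
    have hne : v (j + 1) ≠ v (j + 1 - p) := by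
      have hr' := hv hr
      obtain ⟨a1, a2, a3, a4, -, -, -, a8⟩ := hr'
      rcases a8 with rfl | a8
      · have h1 := le_lastOcc w j (j + 1)
        have h2 := lastOcc_le w (show j + 1 - p ≤ j by omega)
        simp only [v]
        omega
      · rwa [show j + 1 - p = j - p + 1 by omega]
    rcases lt_or_gt_of_ne hne with hlt | hlt
    · obtain ⟨k, hk⟩ := (hv hr).exists_isRootStart hlt
      exact ⟨k, Or.inl hk⟩
    · obtain ⟨k, hk⟩ := (hnv hr).exists_isRootStart (neg_lt_neg hlt)
      exact ⟨k, Or.inr hk⟩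
  choose! f hf using hex
  have hcard : (Set.Icc 1 n \ F).ncard = n - F.ncard := by
    rw [Set.ncard_sdiff hFsub hFfin]
    simp [Set.ncard_eq_toFinset_card']
  have hle : (Runs w n).ncard ≤ (Set.Icc 1 n \ F).ncard := by
    refine Set.ncard_le_ncard_of_injOn f ?_ ?_ ((Set.finite_Icc 1 n).subset Set.sdiff_subset)
    · rintro ⟨i, j, p⟩ hr
      have hk := hf _ hr
      have hr : IsRun w n i j p := hr
      refine ⟨?_, fun hF => ?_⟩
      · have hb : i + 1 ≤ f (i, j, p) ∧ f (i, j, p) ≤ i + p := by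
          rcases hk with hk | hk <;> exact ⟨hk.2.1, hk.2.2.1⟩
        obtain ⟨a1, a2, a3, a4, -⟩ := hr
        exact ⟨by omega, by omega⟩
      · have := hF.not_isRootStart hr
        exact hk.elim this.1 this.2
    · rintro ⟨i, j, p⟩ hr ⟨i', j', p'⟩ hr' heq
      have hk := hf _ hr
      have hk' := hf _ hr'
      rw [← heq] at hk'
      have hr : IsRun w n i j p := hr
      have hr' : IsRun w n i' j' p' := hr'
      rcases hk with hk | hk <;> rcases hk' with hk' | hk'
      · obtain ⟨rfl, rfl, rfl⟩ := hk.eq (hv hr) (hv hr') hk'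
        rfl
      · exact (hk.not_isRootStart_neg (hv hr) (hv hr') hk').elim
      · exact (hk'.not_isRootStart_neg (hv hr') (hv hr) hk).elim
      · obtain ⟨rfl, rfl, rfl⟩ := hk.eq (hnv hr) (hnv hr') hk'
        rfl
  omega
end
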